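/- Let A be a unital C*-algebra whose primitive spectrum is Hausdorff, with center Z, and let ω and ρ be hermitian bounded linear functionals on A. Then ρ lies in the weak* closure of the set ω∘E(A) = {ω∘φ : φ ∈ E(A)} if and only if ρ|Z = ω|Z and ‖cρ‖ ≤ ‖cω‖ for every positive c ∈ Z. -/

import Mathlib

universe u

open scoped ComplexConjugate ComplexOrder

noncomputable section

variable {A : Type u} [NormedRing A] [StarRing A] [CStarRing A]
  [NormedAlgebra ℂ A] [StarModule ℂ A] [CompleteSpace A]

/-- A linear functional on a C*-algebra is positive if it is nonnegative
on all elements of the form `a* a`. -/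
def IsPositiveFunctional (ω : A →L[ℂ] ℂ) : Prop :=
  ∀ a : A, 0 ≤ ω (star a * a)

/-- A state is a positive unital linear functional. -/
def IsState (ω : A →L[ℂ] ℂ) : Prop :=
  IsPositiveFunctional ω ∧ ω 1 = 1

/-- A hermitian (self-adjoint) linear functional. -/
def IsHermitianFunctional (ω : A →L[ℂ] ℂ) : Prop :=
  ∀ a : A, ω (star a) = conj (ω a)

/-- `ωp`, `ωm` form the Jordan decomposition of the hermitian functional `ω`. -/
def IsJordanDecomposition (ω ωp ωm : A →L[ℂ] ℂ) : Prop :=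
  IsPositiveFunctional ωp ∧ IsPositiveFunctional ωm ∧ ω = ωp - ωm ∧ ‖ω‖ = ‖ωp‖ + ‖ωm‖

/-- An element of a C*-algebra is positive iff it is of the form `b* b`. -/
def IsPositiveElem (c : A) : Prop :=
  ∃ b : A, c = star b * b

/-- `E(A)`: the unital completely positive elementary maps
`x ↦ ∑ i, (a i)* x (a i)` with `∑ i, (a i)* (a i) = 1`. -/
def IsElementaryUCP (φ : A →L[ℂ] A) : Prop :=
  ∃ (n : ℕ) (a : Fin n → A), (∑ i, star (a i) * a i) = 1 ∧
    ∀ x : A, φ x = ∑ i, star (a i) * x * a i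

/-- The set `ω ∘ E(A) = {ω ∘ φ : φ ∈ E(A)}`. -/
def mixSet (ω : A →L[ℂ] ℂ) : Set (A →L[ℂ] ℂ) :=
  {ρ | ∃ φ : A →L[ℂ] A, IsElementaryUCP φ ∧ ρ = ω.comp φ}

/-- Membership in the weak* closure of a set of functionals: every basic weak*
neighbourhood of `ρ` (given by finitely many points and `ε > 0`) meets `S`. -/
def InWeakStarClosure (S : Set (A →L[ℂ] ℂ)) (ρ : A →L[ℂ] ℂ) : Prop :=
  ∀ ε : ℝ, 0 < ε → ∀ (n : ℕ) (x : Fin n → A), ∃ σ ∈ S, ∀ i, ‖ρ (x i) - σ (x i)‖ < ε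

/-- Norm-closed two-sided ideals (which in a C*-algebra are automatically
`*`-closed `ℂ`-submodules). -/
def IsClosedIdeal (J : Set A) : Prop :=
  IsClosed J ∧ (0 : A) ∈ J ∧ (∀ x ∈ J, ∀ y ∈ J, x + y ∈ J) ∧
    (∀ (c : ℂ), ∀ x ∈ J, c • x ∈ J) ∧ (∀ (a : A), ∀ x ∈ J, a * x ∈ J ∧ x * a ∈ J)

/-- The norm `‖ω|J‖` of the restriction of a functional `ω` to a subset `J`. -/
def normRestrict (ω : A →L[ℂ] ℂ) (J : Set A) : ℝ :=
  sSup {r : ℝ | ∃ x ∈ J, ‖x‖ ≤ 1 ∧ r = ‖ω x‖}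

/-- The norm `‖cω‖` of the functional `x ↦ ω (c * x)`. -/
def mulNorm (ω : A →L[ℂ] ℂ) (c : A) : ℝ :=
  sSup {r : ℝ | ∃ x : A, ‖x‖ ≤ 1 ∧ r = ‖ω (c * x)‖}

/-- A state `ω` is maximally mixed if every state `ρ` that is more mixed than `ω`
(i.e. `ρ` lies in the weak* closure of `ω ∘ E(A)`) satisfies in turn that `ω` is
more mixed than `ρ`. -/
def IsMaximallyMixed (ω : A →L[ℂ] ℂ) : Prop :=
  IsState ω ∧ ∀ ρ : A →L[ℂ] ℂ, IsState ρ →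
    InWeakStarClosure (mixSet ω) ρ → InWeakStarClosure (mixSet ρ) ω

/-- Maximal (norm-closed two-sided) ideals. -/
def IsMaximalIdeal (N : Set A) : Prop :=
  IsClosedIdeal N ∧ N ≠ Set.univ ∧
    ∀ N' : Set A, IsClosedIdeal N' → N' ≠ Set.univ → N ⊆ N' → N' = N

/-- The strong radical: the intersection of all maximal ideals. -/
def strongRadical (A : Type u) [NormedRing A] [StarRing A] [CStarRing A]
    [NormedAlgebra ℂ A] [StarModule ℂ A] [CompleteSpace A] : Set A :=
  ⋂₀ {N : Set A | IsMaximalIdeal N}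

/-- A witness that `P` is the kernel of an irreducible representation of `A`
on some Hilbert space. -/
structure IrreducibleRepWitness (A : Type u) [NormedRing A] [StarRing A] [CStarRing A]
    [NormedAlgebra ℂ A] [StarModule ℂ A] [CompleteSpace A] (P : Set A) :
    Type (u + 1) where
  /-- the Hilbert space of the representation -/
  space : Type u
  [nacg : NormedAddCommGroup space]
  [ips : InnerProductSpace ℂ space]
  [cplt : CompleteSpace space]
  [nontriv : Nontrivial space]
  /-- the representation -/
  π : A →L[ℂ] (space →L[ℂ] space)
  map_mul' : ∀ x y : A, π (x * y) = π x * π y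
  map_star' : ∀ x : A, π (star x) = star (π x)
  map_one' : π 1 = 1
  /-- topological irreducibility: every nonzero vector is cyclic -/
  irreducible' : ∀ ξ : space, ξ ≠ 0 → Dense {η : space | ∃ a : A, η = π a ξ}
  ker_eq' : P = {a : A | π a = 0}

/-- `P` is a primitive ideal: the kernel of some irreducible representation. -/
def IsPrimitiveIdeal (P : Set A) : Prop :=
  Nonempty (IrreducibleRepWitness A P)

/-- The primitive spectrum of `A` is Hausdorff: any two distinct points of the
primitive spectrum can be separated by disjoint basic open sets of the
hull-kernel topology. -/
def HasHausdorffPrimitiveSpectrum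
    (A : Type u) [NormedRing A] [StarRing A] [CStarRing A]
    [NormedAlgebra ℂ A] [StarModule ℂ A] [CompleteSpace A] : Prop :=
  ∀ P Q : Set A, IsPrimitiveIdeal P → IsPrimitiveIdeal Q → P ≠ Q →
    ∃ I J : Set A, IsClosedIdeal I ∧ IsClosedIdeal J ∧ ¬I ⊆ P ∧ ¬J ⊆ Q ∧
      ∀ S : Set A, IsPrimitiveIdeal S → I ⊆ S ∨ J ⊆ S


section Aux1

variable {B : Type u} [CStarAlgebra B] [PartialOrder B] [StarOrderedRing B]

set_option linter.unusedSectionVars false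

lemma norm_one_le_aux : ‖(1 : B)‖ ≤ 1 := by
  rcases subsingleton_or_nontrivial B with h | h
  · rw [Subsingleton.elim (1 : B) 0, norm_zero]; exact zero_le_one
  · exact CStarRing.norm_one.le

/-- States, with norm bound included. -/
structure IsSt (τ : B →L[ℂ] ℂ) : Prop where
  pos : ∀ a : B, 0 ≤ τ (star a * a)
  one : τ 1 = 1
  norm : ‖τ‖ ≤ 1

lemma IsSt.nonneg {τ : B →L[ℂ] ℂ} (h : IsSt τ) {a : B} (ha : 0 ≤ a) : 0 ≤ τ a := by
  obtain ⟨b, rfl⟩ := CStarAlgebra.nonneg_iff_eq_star_mul_self.mp ha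
  exact h.pos b

lemma IsSt.mono {τ : B →L[ℂ] ℂ} (h : IsSt τ) {a b : B} (hab : a ≤ b) : (τ a).re ≤ (τ b).re := by
  have := h.nonneg (sub_nonneg.mpr hab)
  rw [map_sub] at this
  have := (Complex.le_def.mp this).1
  simp at this
  exact this

/-- the associated positive linear map -/
def IsSt.toPos {τ : B →L[ℂ] ℂ} (h : IsSt τ) : B →ₚ[ℂ] ℂ :=
  PositiveLinearMap.mk₀ τ.toLinearMap (fun _ hx => h.nonneg hx)

lemma IsSt.toPos_apply {τ : B →L[ℂ] ℂ} (h : IsSt τ) (a : B) : h.toPos a = τ a := rfl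

lemma IsSt.map_star_conj {τ : B →L[ℂ] ℂ} (h : IsSt τ) (a : B) : τ (star a) = conj (τ a) := by
  have := map_star h.toPos a
  simpa [h.toPos_apply] using this

lemma IsSt.eq_re {τ : B →L[ℂ] ℂ} (h : IsSt τ) {a : B} (ha : IsSelfAdjoint a) :
    τ a = ((τ a).re : ℂ) := by
  have := h.map_star_conj a
  rw [ha.star_eq] at this
  exact (Complex.conj_eq_iff_re.mp this.symm).symm

lemma IsSt.cs {τ : B →L[ℂ] ℂ} (h : IsSt τ) {x : B} (hx : τ (star x * x) = 0) (y : B) :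
    τ (y * x) = 0 := by
  have h1 := norm_inner_le_norm (𝕜 := ℂ) (h.toPos.toPreGNS (star y)) (h.toPos.toPreGNS x)
  have h2 : ‖h.toPos.toPreGNS x‖ = 0 := by
    rw [PositiveLinearMap.preGNS_norm_def]
    simp [h.toPos_apply, hx]
  rw [h2, mul_zero, PositiveLinearMap.preGNS_inner_def] at h1
  simpa [h.toPos_apply] using h1

lemma IsSt.of_norm {τ : B →L[ℂ] ℂ} (hn : ‖τ‖ ≤ 1) (h1 : τ 1 = 1) : IsSt τ := by
  have hle : ∀ x, ‖τ x‖ ≤ ‖x‖ := fun x => by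
    have := τ.le_opNorm x
    nlinarith [norm_nonneg x]
  have hone : ‖(1 : B)‖ ≤ 1 := norm_one_le_aux
  have hreal : ∀ a : B, IsSelfAdjoint a → (τ a).im = 0 := by
    intro a ha
    have key : ∀ t : ℝ, 2 * t * (τ a).im ≤ ‖a‖ ^ 2 := by
      intro t
      have e1 : ‖a + ((t : ℂ) * Complex.I) • (1 : B)‖ ^ 2 ≤ ‖a‖ ^ 2 + t ^ 2 := by
        rw [sq, ← CStarRing.norm_star_mul_self]
        have : star (a + ((t : ℂ) * Complex.I) • (1 : B)) * (a + ((t : ℂ) * Complex.I) • (1 : B))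
            = a * a + ((t : ℂ) ^ 2) • (1 : B) := by
          simp only [star_add, ha.star_eq, star_smul, star_one, star_mul', Complex.star_def,
            Complex.conj_ofReal, Complex.conj_I, add_mul, mul_add, smul_mul_assoc, mul_smul_comm,
            mul_one, one_mul]
          have : (t : ℂ) * -Complex.I * (↑t * Complex.I) = (t : ℂ) ^ 2 := by
            linear_combination (- (t : ℂ) ^ 2) * Complex.I_sq
          rw [smul_add, smul_smul, mul_comm ((t : ℂ) * Complex.I), this]
          module
        rw [this]
        calc _ ≤ ‖a * a‖ + ‖((t : ℂ) ^ 2) • (1 : B)‖ := norm_add_le _ _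
          _ ≤ ‖a‖ ^ 2 + t ^ 2 := by
            gcongr
            · rw [sq]; exact norm_mul_le _ _
            · rw [norm_smul]; simp; nlinarith [sq_nonneg t]
      have e2 := hle (a + ((t : ℂ) * Complex.I) • (1 : B))
      have e3 : ((τ a).im + t) ^ 2 ≤ ‖τ (a + ((t : ℂ) * Complex.I) • (1 : B))‖ ^ 2 := by
        rw [map_add, map_smul, h1, Complex.sq_norm, Complex.normSq_apply]
        simp
        nlinarith [sq_nonneg (τ a).re]
      have e4 := pow_le_pow_left₀ (norm_nonneg _) e2 2
      nlinarith [sq_nonneg (τ a).im]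
    by_contra hne
    have := key ((‖a‖ ^ 2 + 1) / (2 * (τ a).im))
    have h2 : 2 * ((‖a‖ ^ 2 + 1) / (2 * (τ a).im)) * (τ a).im = ‖a‖ ^ 2 + 1 := by field_simp
    linarith
  refine ⟨?_, h1, hn⟩
  intro a
  set b := star a * a with hb
  have hb0 : 0 ≤ b := star_mul_self_nonneg a
  have him := hreal b (IsSelfAdjoint.of_nonneg hb0)
  rw [Complex.nonneg_iff]
  refine ⟨?_, him.symm⟩
  have hb1 : ‖algebraMap ℝ B ‖b‖ - b‖ ≤ ‖b‖ := by
    have h0 : 0 ≤ algebraMap ℝ B ‖b‖ - b :=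
      sub_nonneg.mpr (IsSelfAdjoint.le_algebraMap_norm_self (IsSelfAdjoint.of_nonneg hb0))
    have : algebraMap ℝ B ‖b‖ - b ≤ algebraMap ℝ B ‖b‖ := sub_le_self _ hb0
    have := CStarAlgebra.norm_le_norm_of_nonneg_of_le h0 this
    refine this.trans ?_
    rw [Algebra.algebraMap_eq_smul_one, norm_smul]
    simp
    nlinarith [norm_nonneg b]
  have h3 := (hle _).trans hb1
  have h4 : τ (algebraMap ℝ B ‖b‖ - b) = (‖b‖ : ℂ) - τ b := by
    rw [map_sub, Algebra.algebraMap_eq_smul_one, ← Complex.coe_smul, map_smul, h1]; simp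
  rw [h4] at h3
  have h5 := (Complex.re_le_norm _).trans h3
  simp at h5
  exact h5

/-- Hahn--Banach: a subspace staying at distance at least one from `1` is annihilated by a state. -/
lemma exists_st_of_submodule (L : Submodule ℂ B) (hL : ∀ x ∈ L, 1 ≤ ‖1 - x‖) :
    ∃ τ : B →L[ℂ] ℂ, IsSt τ ∧ ∀ x ∈ L, τ x = 0 := by
  let q : B →L[ℂ] (B ⧸ L) := L.mkQL
  have hq : ‖q 1‖ = 1 := by
    apply le_antisymm
    · exact (Submodule.Quotient.norm_mk_le L 1).trans norm_one_le_aux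
    · by_contra hlt
      push Not at hlt
      obtain ⟨m, hm, hm2⟩ := Submodule.Quotient.norm_mk_lt (S := L) (q 1) (sub_pos.mpr hlt)
      have : 1 - m ∈ L := by
        rw [← Submodule.Quotient.eq]; exact hm.symm
      have := hL _ this
      simp at this
      linarith
  obtain ⟨g, hg1, hg2⟩ := exists_dual_vector ℂ (q 1) (by rw [hq]; exact one_ne_zero)
  refine ⟨g.comp q, IsSt.of_norm ?_ ?_, ?_⟩
  · refine ContinuousLinearMap.opNorm_le_bound _ zero_le_one (fun x => ?_)
    have := g.le_opNorm (q x)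
    rw [hg1] at this
    refine this.trans ?_
    simp only [one_mul]
    exact Submodule.Quotient.norm_mk_le L x
  · simp [hg2, hq]
  · intro x hx
    have : q x = 0 := (Submodule.Quotient.mk_eq_zero L).mpr hx
    simp [this]

lemma one_le_norm_one_sub {x : B} (hx : ¬ IsUnit x) : 1 ≤ ‖1 - x‖ := by
  by_contra h
  push Not at h
  apply hx
  have := isUnit_one_sub_of_norm_lt_one h
  simpa using this

end Aux1

section Aux2

set_option linter.unusedSectionVars false

variable {B : Type u} [CStarAlgebra B] [PartialOrder B] [StarOrderedRing B]

lemma exists_vecSt {H : Type u} [NormedAddCommGroup H] [InnerProductSpace ℂ H] [CompleteSpace H]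
    (π : B →⋆ₐ[ℂ] (H →L[ℂ] H)) (ξ : H) (hξ : ‖ξ‖ = 1) :
    ∃ τ : B →L[ℂ] ℂ, IsSt τ ∧ ∀ a, τ a = inner ℂ ξ (π a ξ) := by
  let f : B →ₗ[ℂ] ℂ :=
    { toFun := fun a => inner ℂ ξ (π a ξ)
      map_add' := by intro a b; simp
      map_smul' := by intro c a; simp }
  have hb : ∀ a, ‖f a‖ ≤ 1 * ‖a‖ := by
    intro a
    have h1 : ‖inner ℂ ξ (π a ξ)‖ ≤ ‖ξ‖ * ‖π a ξ‖ := norm_inner_le_norm _ _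
    have h2 := (π a).le_opNorm ξ
    have h3 : ‖π a‖ ≤ ‖a‖ := NonUnitalStarAlgHom.norm_apply_le π a
    rw [hξ] at h1 h2
    change ‖inner ℂ ξ (π a ξ)‖ ≤ _
    linarith
  refine ⟨f.mkContinuous 1 hb, IsSt.of_norm ?_ ?_, fun a => rfl⟩
  · exact f.mkContinuous_norm_le zero_le_one hb
  · change inner ℂ ξ (π 1 ξ) = 1
    rw [map_one]
    simp [hξ]

/-- purity, in elementary terms -/
def IsPureSt (τ : B →L[ℂ] ℂ) : Prop :=
  IsSt τ ∧ ∀ τ₁ τ₂ : B →L[ℂ] ℂ, IsSt τ₁ → IsSt τ₂ → ∀ s t : ℝ, 0 < s → 0 < t → s + t = 1 →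
    (∀ x, τ x = s * τ₁ x + t * τ₂ x) → ∀ x, τ₁ x = τ x

lemma exists_dec {H : Type u} [NormedAddCommGroup H] [InnerProductSpace ℂ H] [CompleteSpace H]
    (π : B →⋆ₐ[ℂ] (H →L[ℂ] H)) (Ω : H) (hΩ : ‖Ω‖ = 1) (hd : Dense {η : H | ∃ a : B, η = π a Ω})
    (τ : B →L[ℂ] ℂ) (hτ : IsPureSt τ) (hτΩ : ∀ a, τ a = inner ℂ Ω (π a Ω))
    (V : Submodule ℂ H) [V.HasOrthogonalProjection] (hV : ∀ a : B, ∀ v ∈ V, π a v ∈ V)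
    (hV0 : V ≠ ⊥) : V = ⊤ := by
  have hVp : ∀ a : B, ∀ v ∈ Vᗮ, π a v ∈ Vᗮ := by
    intro a v hv
    rw [Submodule.mem_orthogonal] at hv ⊢
    intro w hw
    have h1 : inner ℂ w (π a v) = inner ℂ (π (star a) w) v := by
      rw [map_star, ContinuousLinearMap.star_eq_adjoint, ContinuousLinearMap.adjoint_inner_left]
    rw [h1]
    exact hv _ (hV _ _ hw)
  obtain ⟨p, hp, q, hq, hpq⟩ : ∃ p ∈ V, ∃ q ∈ Vᗮ, Ω = p + q :=
    ⟨V.starProjection Ω, V.starProjection_apply_mem Ω, _,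
      V.sub_starProjection_mem_orthogonal Ω, (add_sub_cancel _ _).symm⟩
  have hπp : ∀ a : B, π a p ∈ V := fun a => hV a p hp
  have hπq : ∀ a : B, π a q ∈ Vᗮ := fun a => hVp a q hq
  have orth : ∀ v ∈ V, ∀ w ∈ Vᗮ, inner ℂ v w = 0 := fun v hv w hw =>
    Submodule.inner_right_of_mem_orthogonal hv hw
  have orth' : ∀ v ∈ V, ∀ w ∈ Vᗮ, inner ℂ w v = 0 := fun v hv w hw =>
    Submodule.inner_left_of_mem_orthogonal hv hw
  have hdV : ∀ U : Submodule ℂ H, IsClosed (U : Set H) → (∀ a, π a Ω ∈ U) → U = ⊤ := by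
    intro U hUc hU
    rw [Submodule.eq_top_iff']
    intro x
    have : closure {η : H | ∃ a : B, η = π a Ω} ⊆ U := by
      apply closure_minimal _ hUc
      rintro _ ⟨a, rfl⟩
      exact hU a
    exact this (hd x)
  have hVc : IsClosed (V : Set H) := by
    rw [← Submodule.orthogonal_orthogonal V]
    exact Submodule.isClosed_orthogonal _
  by_cases hp0 : p = 0
  · exfalso
    have : Vᗮ = ⊤ := by
      apply hdV _ (Submodule.isClosed_orthogonal _)
      intro a
      rw [hpq, hp0, zero_add]
      exact hπq a
    apply hV0
    rw [← Submodule.orthogonal_orthogonal V, this, Submodule.top_orthogonal_eq_bot]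
  by_cases hq0 : q = 0
  · apply hdV _ hVc
    intro a
    rw [hpq, hq0, add_zero]
    exact hπp a
  exfalso
  have hnp : 0 < ‖p‖ := norm_pos_iff.mpr hp0
  have hnq : 0 < ‖q‖ := norm_pos_iff.mpr hq0
  have hsum : ‖p‖ ^ 2 + ‖q‖ ^ 2 = 1 := by
    have := norm_add_sq_eq_norm_sq_add_norm_sq_of_inner_eq_zero p q (orth p hp q hq)
    rw [← hpq, hΩ] at this
    nlinarith
  obtain ⟨τ₁, h1, h1'⟩ := exists_vecSt π (((‖p‖⁻¹ : ℝ) : ℂ) • p) (by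
    rw [norm_smul]; simp; field_simp)
  obtain ⟨τ₂, h2, h2'⟩ := exists_vecSt π (((‖q‖⁻¹ : ℝ) : ℂ) • q) (by
    rw [norm_smul]; simp; field_simp)
  have e1 : ∀ a, ((‖p‖ ^ 2 : ℝ) : ℂ) * τ₁ a = inner ℂ p (π a p) := by
    intro a
    rw [h1', map_smul, inner_smul_left, inner_smul_right, Complex.conj_ofReal]
    have : (‖p‖ : ℂ) ≠ 0 := by exact_mod_cast hnp.ne'
    push_cast
    field_simp
  have e2 : ∀ a, ((‖q‖ ^ 2 : ℝ) : ℂ) * τ₂ a = inner ℂ q (π a q) := by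
    intro a
    rw [h2', map_smul, inner_smul_left, inner_smul_right, Complex.conj_ofReal]
    have : (‖q‖ : ℂ) ≠ 0 := by exact_mod_cast hnq.ne'
    push_cast
    field_simp
  have hdec : ∀ x, τ x = ((‖p‖ ^ 2 : ℝ) : ℂ) * τ₁ x + ((‖q‖ ^ 2 : ℝ) : ℂ) * τ₂ x := by
    intro x
    rw [e1, e2, hτΩ, hpq, map_add, inner_add_left, inner_add_right, inner_add_right,
      orth p hp _ (hπq x), orth' _ (hπp x) q hq]
    simp
  have heq := hτ.2 τ₁ τ₂ h1 h2 _ _ (by positivity) (by positivity) hsum hdec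
  -- p = ‖p‖^2 Ω
  have hperp : ∀ x : H, inner ℂ (p - ((‖p‖ ^ 2 : ℝ) : ℂ) • Ω) x = 0 := by
    intro x
    refine hd.induction (P := fun x => inner ℂ (p - ((‖p‖ ^ 2 : ℝ) : ℂ) • Ω) x = 0) ?_ ?_ x
    · rintro _ ⟨a, rfl⟩
      rw [inner_sub_left, inner_smul_left, Complex.conj_ofReal, ← hτΩ, ← heq, e1]
      rw [hpq, map_add, inner_add_right, orth p hp _ (hπq a)]
      simp
    · exact isClosed_eq (by fun_prop) continuous_const
  have hpz : p - ((‖p‖ ^ 2 : ℝ) : ℂ) • Ω = 0 := by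
    have := hperp (p - ((‖p‖ ^ 2 : ℝ) : ℂ) • Ω)
    exact inner_self_eq_zero.mp this
  have := hperp q
  rw [inner_sub_left, orth p hp q hq, inner_smul_left, Complex.conj_ofReal, hpq, inner_add_left,
    orth p hp q hq, zero_add, zero_sub, neg_eq_zero, mul_eq_zero] at this
  rcases this with h | h
  · norm_cast at h
    have : 0 < ‖p‖ ^ 2 := by positivity
    exact this.ne' h
  · exact hq0 (inner_self_eq_zero.mp h)

/-- The kernel of the GNS representation of a pure state is a primitive ideal. -/
lemma IsPureSt.exists_prim {τ : B →L[ℂ] ℂ} (hτ : IsPureSt τ) :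
    ∃ P : Set B, IsPrimitiveIdeal P ∧ (∀ x ∈ P, τ x = 0) ∧
      ∀ x, (∀ a b, τ (a * x * b) = 0) → x ∈ P := by
  let f := hτ.1.toPos
  let π := f.gnsStarAlgHom
  let Ω : f.GNS := (f.toPreGNS 1 : f.PreGNS)
  have hπΩ : ∀ a, π a Ω = ((f.toPreGNS a : f.PreGNS) : f.GNS) := by
    intro a
    change f.gnsNonUnitalStarAlgHom a _ = _
    rw [PositiveLinearMap.gnsNonUnitalStarAlgHom_apply_coe]
    simp
  have hτΩ : ∀ a, τ a = inner ℂ Ω (π a Ω) := by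
    intro a
    rw [hπΩ, UniformSpace.Completion.inner_coe, PositiveLinearMap.preGNS_inner_def]
    simp [f, hτ.1.toPos_apply]
  have hΩ : ‖Ω‖ = 1 := by
    have h := hτΩ 1
    rw [map_one π, hτ.1.one] at h
    have h2 : inner ℂ Ω Ω = 1 := h.symm
    have h3 : ‖Ω‖ ^ 2 = 1 := by
      have := inner_self_eq_norm_sq (𝕜 := ℂ) Ω
      rw [h2] at this
      rw [← this]
      exact RCLike.one_re
    nlinarith [norm_nonneg Ω]
  have hd : Dense {η : f.GNS | ∃ a : B, η = π a Ω} := by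
    have := UniformSpace.Completion.denseRange_coe (α := f.PreGNS)
    refine Dense.mono ?_ this
    rintro _ ⟨a, rfl⟩
    exact ⟨f.ofPreGNS a, by rw [hπΩ]; rfl⟩
  have hnt : Nontrivial f.GNS := ⟨Ω, 0, by
    intro h; rw [h, norm_zero] at hΩ; exact zero_ne_one hΩ⟩
  have hπn : ∀ a, ‖π a‖ ≤ ‖a‖ := fun a => NonUnitalStarAlgHom.norm_apply_le π a
  refine ⟨{a : B | π a = 0}, ⟨{
    space := f.GNS
    π := (π : B →ₗ[ℂ] (f.GNS →L[ℂ] f.GNS)).mkContinuous 1 (fun a => by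
      rw [one_mul]; exact hπn a)
    map_mul' := fun x y => map_mul π x y
    map_star' := fun x => map_star π x
    map_one' := map_one π
    irreducible' := ?_
    ker_eq' := rfl }⟩, ?_, ?_⟩
  · intro ξ hξ
    let V0 : Submodule ℂ f.GNS :=
      { carrier := {η | ∃ a : B, η = π a ξ}
        add_mem' := by
          rintro _ _ ⟨a, rfl⟩ ⟨b, rfl⟩
          exact ⟨a + b, by simp⟩
        zero_mem' := ⟨0, by simp⟩
        smul_mem' := by
          rintro c _ ⟨a, rfl⟩
          exact ⟨c • a, by simp⟩ }
    have hcl : V0.topologicalClosure = ⊤ := by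
      have : CompleteSpace V0.topologicalClosure :=
        V0.isClosed_topologicalClosure.completeSpace_coe
      refine exists_dec π Ω hΩ hd τ hτ hτΩ V0.topologicalClosure ?_ ?_
      · intro a v hv
        have hm : Set.MapsTo (π a) (V0 : Set f.GNS) (V0 : Set f.GNS) := by
          rintro _ ⟨b, rfl⟩
          exact ⟨a * b, by simp⟩
        exact hm.closure (π a).continuous hv
      · intro hbot
        have : ξ ∈ V0.topologicalClosure := V0.le_topologicalClosure ⟨1, by simp⟩
        rw [hbot] at this
        exact hξ this
    have : Dense (V0 : Set f.GNS) := by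
      rw [dense_iff_closure_eq]
      have := congrArg (fun W : Submodule ℂ f.GNS => (W : Set f.GNS)) hcl
      simpa using this
    exact this
  · intro x hx
    rw [hτΩ, show π x = 0 from hx]
    simp
  · intro x hx
    change π x = 0
    have h1 : ∀ b, π x (π b Ω) = 0 := by
      intro b
      have h2 : ∀ y, inner ℂ y (π x (π b Ω)) = 0 := by
        intro y
        refine hd.induction (P := fun y => inner ℂ y (π x (π b Ω)) = 0) ?_ ?_ y
        · rintro _ ⟨a, rfl⟩
          rw [← ContinuousLinearMap.adjoint_inner_right, ← ContinuousLinearMap.star_eq_adjoint,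
            ← map_star]
          have := hx (star a) b
          rw [hτΩ, map_mul, map_mul] at this
          exact this
        · exact isClosed_eq (by fun_prop) continuous_const
      exact inner_self_eq_zero.mp (h2 _)
    ext y
    refine hd.induction (P := fun y => π x y = (0 : f.GNS →L[ℂ] f.GNS) y) ?_ ?_ y
    · rintro _ ⟨a, rfl⟩
      rw [h1]; rfl
    · exact isClosed_eq (by fun_prop) (by fun_prop)

end Aux2

section Aux3

set_option linter.unusedSectionVars false

variable {B : Type u} [CStarAlgebra B] [PartialOrder B] [StarOrderedRing B]

/-- the set of states in the weak dual vanishing on a set -/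
def stSet (I : Set B) : Set (WeakDual ℂ B) :=
  {τ | IsSt (WeakDual.toStrongDual τ) ∧ ∀ x ∈ I, τ x = 0}

lemma isCompact_stSet (I : Set B) : IsCompact (stSet I) := by
  have h1 := WeakDual.isCompact_closedBall (𝕜 := ℂ) (E := B) 0 1
  refine h1.of_isClosed_subset ?_ ?_
  · have : stSet I = (WeakDual.toStrongDual ⁻¹' Metric.closedBall (0 : StrongDual ℂ B) 1) ∩
        ((⋂ a : B, {τ : WeakDual ℂ B | 0 ≤ τ (star a * a)}) ∩
          ({τ : WeakDual ℂ B | τ 1 = 1} ∩ ⋂ x ∈ I, {τ : WeakDual ℂ B | τ x = 0})) := by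
      ext τ
      simp only [stSet, Set.mem_ofPred_eq, Set.mem_inter_iff, Set.mem_preimage, Set.mem_iInter,
        mem_closedBall_zero_iff]
      constructor
      · rintro ⟨⟨a, b, c⟩, d⟩
        exact ⟨c, a, b, d⟩
      · rintro ⟨c, a, b, d⟩
        exact ⟨⟨a, b, c⟩, d⟩
    rw [this]
    refine (WeakDual.isClosed_closedBall 0 1).inter (.inter ?_ (.inter ?_ ?_))
    · exact isClosed_iInter fun a => isClosed_le continuous_const (WeakDual.eval_continuous _)
    · exact isClosed_eq (WeakDual.eval_continuous _) continuous_const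
    · exact isClosed_biInter fun a _ => isClosed_eq (WeakDual.eval_continuous _) continuous_const
  · rintro τ ⟨hτ, -⟩
    simpa using hτ.norm

lemma exists_max_st (I : Set B) (h : B) {τ₀ : B →L[ℂ] ℂ} (hτ₀ : IsSt τ₀)
    (hI : ∀ x ∈ I, τ₀ x = 0) :
    ∃ σ : B →L[ℂ] ℂ, IsSt σ ∧ (∀ x ∈ I, σ x = 0) ∧
      ∀ τ : B →L[ℂ] ℂ, IsSt τ → (∀ x ∈ I, τ x = 0) → (τ h).re ≤ (σ h).re := by
  have hc : ContinuousOn (fun τ : WeakDual ℂ B => (τ h).re) (stSet I) :=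
    (Complex.continuous_re.comp (WeakDual.eval_continuous h)).continuousOn
  obtain ⟨σ, hσ, hmax⟩ := (isCompact_stSet I).exists_isMaxOn
    ⟨StrongDual.toWeakDual τ₀, hτ₀, hI⟩ hc
  exact ⟨WeakDual.toStrongDual σ, hσ.1, hσ.2, fun τ h1 h2 =>
    hmax (show StrongDual.toWeakDual τ ∈ stSet I from ⟨h1, h2⟩)⟩

lemma exists_pure (I : Set B) (hI : ∀ x ∈ I, star x * x ∈ I) (h : B) {τ₀ : B →L[ℂ] ℂ}
    (hτ₀ : IsSt τ₀) (hτI : ∀ x ∈ I, τ₀ x = 0) :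
    ∃ σ : B →L[ℂ] ℂ, IsPureSt σ ∧ (∀ x ∈ I, σ x = 0) ∧ (τ₀ h).re ≤ (σ h).re := by
  obtain ⟨σm, hm1, hm2, hm3⟩ := exists_max_st I h hτ₀ hτI
  set F : Set (WeakDual ℂ B) := stSet I ∩ {τ : WeakDual ℂ B | (σm h).re ≤ (τ h).re} with hF
  have hFc : IsCompact F := (isCompact_stSet I).inter_right
    (isClosed_le continuous_const (Complex.continuous_re.comp (WeakDual.eval_continuous h)))
  have hFne : F.Nonempty := ⟨StrongDual.toWeakDual σm, ⟨hm1, hm2⟩, le_refl (σm h).re⟩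
  have : LocallyConvexSpace ℝ (WeakDual ℂ B) := WeakBilin.locallyConvexSpace
  obtain ⟨σ, hσ⟩ := hFc.extremePoints_nonempty hFne
  rw [mem_extremePoints] at hσ
  obtain ⟨⟨⟨hσ1, hσ2⟩, hσ3⟩, hσ4⟩ := hσ
  refine ⟨WeakDual.toStrongDual σ, ⟨hσ1, ?_⟩, hσ2, (hm3 τ₀ hτ₀ hτI).trans hσ3⟩
  intro τ₁ τ₂ h1 h2 s t hs ht hst hdec
  have hre : ∀ x, (σ x).re = s * (τ₁ x).re + t * (τ₂ x).re := by
    intro x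
    have := hdec x
    change σ x = _ at this
    rw [this]
    simp
  have hv : ∀ x ∈ I, τ₁ x = 0 ∧ τ₂ x = 0 := by
    intro x hx
    have e1 := hre (star x * x)
    rw [show σ (star x * x) = 0 from hσ2 _ (hI x hx)] at e1
    have p1 := Complex.nonneg_iff.mp (h1.pos x)
    have p2 := Complex.nonneg_iff.mp (h2.pos x)
    have q1 : (τ₁ (star x * x)).re = 0 := by
      have := mul_nonneg ht.le p2.1
      have := mul_nonneg hs.le p1.1
      have : s * (τ₁ (star x * x)).re = 0 := by simp at e1; linarith
      simpa [hs.ne'] using this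
    have q2 : (τ₂ (star x * x)).re = 0 := by
      have : t * (τ₂ (star x * x)).re = 0 := by simp [q1] at e1; simpa using e1
      simpa [ht.ne'] using this
    have r1 : τ₁ (star x * x) = 0 := Complex.ext q1 p1.2.symm
    have r2 : τ₂ (star x * x) = 0 := Complex.ext q2 p2.2.symm
    exact ⟨by simpa using h1.cs r1 1, by simpa using h2.cs r2 1⟩
  have b1 := hm3 τ₁ h1 (fun x hx => (hv x hx).1)
  have b2 := hm3 τ₂ h2 (fun x hx => (hv x hx).2)
  have hσ3' : (σm h).re ≤ (σ h).re := hσ3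
  rw [hre h] at hσ3'
  have c1 : (σm h).re ≤ (τ₁ h).re := by
    by_contra hlt
    push Not at hlt
    have : t = 1 - s := by linarith
    subst this
    nlinarith
  have c2 : (σm h).re ≤ (τ₂ h).re := by
    by_contra hlt
    push Not at hlt
    have : s = 1 - t := by linarith
    subst this
    nlinarith
  have := hσ4 (StrongDual.toWeakDual τ₁) ⟨⟨h1, fun x hx => (hv x hx).1⟩, c1⟩
    (StrongDual.toWeakDual τ₂) ⟨⟨h2, fun x hx => (hv x hx).2⟩, c2⟩
    ⟨s, t, hs, ht, hst, by
      refine DFunLike.ext _ _ fun x => ?_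
      have := hdec x
      change σ x = _ at this
      rw [this]
      change (s • (τ₁ x) + t • (τ₂ x) : ℂ) = _
      simp⟩
  intro x
  have := congrArg (fun τ : WeakDual ℂ B => τ x) (show StrongDual.toWeakDual τ₁ = σ by tauto)
  exact this

/-- From a state vanishing on a two-sided multiplicative set to a primitive ideal. -/
lemma exists_prim_of_st (I : Set B) (hI : ∀ x ∈ I, ∀ a b, a * x * b ∈ I) (h : B)
    {τ₀ : B →L[ℂ] ℂ} (hτ₀ : IsSt τ₀) (hτI : ∀ x ∈ I, τ₀ x = 0) :
    ∃ (P : Set B) (σ : B →L[ℂ] ℂ), IsPrimitiveIdeal P ∧ I ⊆ P ∧ IsSt σ ∧ (∀ x ∈ P, σ x = 0) ∧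
      (τ₀ h).re ≤ (σ h).re := by
  obtain ⟨σ, h1, h2, h3⟩ := exists_pure I (fun x hx => by simpa using hI x hx (star x) 1) h hτ₀ hτI
  obtain ⟨P, hP, hP1, hP2⟩ := h1.exists_prim
  exact ⟨P, σ, hP, fun x hx => hP2 x (fun a b => h2 _ (hI x hx a b)), h1.1, hP1, h3⟩

/-- A proper two-sided ideal is contained in a primitive ideal. -/
lemma exists_prim_of_proper (W : Submodule ℂ B) (hW : ∀ x ∈ W, ∀ a b, a * x * b ∈ W)
    (h1 : (1 : B) ∉ W) : ∃ P : Set B, IsPrimitiveIdeal P ∧ (W : Set B) ⊆ P := by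
  obtain ⟨τ, hτ, hτ2⟩ := exists_st_of_submodule W (fun x hx => one_le_norm_one_sub (fun hu => by
    apply h1
    obtain ⟨u, rfl⟩ := hu
    simpa using hW _ hx (↑u⁻¹) 1))
  obtain ⟨P, σ, hP, hIP, -⟩ := exists_prim_of_st (W : Set B) hW 0 hτ hτ2
  exact ⟨P, hP, hIP⟩

/-- A noninvertible self-adjoint element is killed by a state, together with its left ideal. -/
lemma exists_st_of_not_isUnit {y : B} (hy : IsSelfAdjoint y) (hu : ¬ IsUnit y) :
    ∃ τ : B →L[ℂ] ℂ, IsSt τ ∧ τ y = 0 := by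
  let L : Submodule ℂ B := LinearMap.range (LinearMap.mulRight ℂ y)
  obtain ⟨τ, hτ, hτ2⟩ := exists_st_of_submodule L (by
    rintro _ ⟨a, rfl⟩
    apply one_le_norm_one_sub
    intro hua
    apply hu
    obtain ⟨u, hu⟩ := hua
    have hl : (↑u⁻¹ * a) * y = 1 := by
      have : a * y = u := hu.symm
      rw [mul_assoc, this]; simp
    have hr : y * star (↑u⁻¹ * a) = 1 := by
      have := congrArg star hl
      rwa [star_mul, hy.star_eq, star_one] at this
    exact ⟨⟨y, _, hr, by rw [← left_inv_eq_right_inv hl hr]; exact hl⟩, rfl⟩)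
  exact ⟨τ, hτ, hτ2 _ ⟨1, by simp⟩⟩

/-- Positivity may be tested on pairs (primitive ideal, state on the quotient). -/
lemma nonneg_of_forall_prim {y : B} (hy : IsSelfAdjoint y)
    (h : ∀ (P : Set B) (τ : B →L[ℂ] ℂ), IsPrimitiveIdeal P → IsSt τ → (∀ x ∈ P, τ x = 0) →
      0 ≤ (τ y).re) : 0 ≤ y := by
  rw [StarOrderedRing.nonneg_iff_spectrum_nonneg (R := ℝ) y]
  intro r hr
  by_contra hneg
  push Not at hneg
  have hu : ¬ IsUnit (algebraMap ℝ B r - y) := hr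
  obtain ⟨τ, hτ, hτ0⟩ := exists_st_of_not_isUnit
    ((IsSelfAdjoint.algebraMap B (IsSelfAdjoint.all r)).sub hy) hu
  have hτy : τ y = r := by
    rw [map_sub, Algebra.algebraMap_eq_smul_one, ← Complex.coe_smul, map_smul, hτ.one] at hτ0
    simp at hτ0
    linear_combination -hτ0
  obtain ⟨P, σ, hP, -, hσ, hσP, hle⟩ := exists_prim_of_st (∅ : Set B) (by simp) (-y) hτ (by simp)
  have := h P σ hP hσ hσP
  simp [hτy] at hle
  linarith

end Aux3

section Aux4

set_option linter.unusedSectionVars false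

variable {B : Type u} [CStarAlgebra B] [PartialOrder B] [StarOrderedRing B]

/-- two-sided ideals as submodules -/
def IsId (W : Submodule ℂ B) : Prop := ∀ x ∈ W, ∀ a b : B, a * x * b ∈ W

/-- the star homomorphism of a witness -/
lemma exists_rep {P : Set B} (hP : IsPrimitiveIdeal P) :
    ∃ (H : Type u) (_ : NormedAddCommGroup H) (_ : InnerProductSpace ℂ H) (_ : CompleteSpace H)
      (_ : Nontrivial H) (π : B →⋆ₐ[ℂ] (H →L[ℂ] H)), ∀ x, x ∈ P ↔ π x = 0 := by
  obtain ⟨W⟩ := hP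
  letI := W.nacg
  letI := W.ips
  letI := W.cplt
  letI := W.nontriv
  let π : B →⋆ₐ[ℂ] (W.space →L[ℂ] W.space) :=
    { toFun := W.π
      map_one' := W.map_one'
      map_mul' := W.map_mul'
      map_zero' := map_zero W.π
      map_add' := map_add W.π
      commutes' := by
        intro r
        rw [Algebra.algebraMap_eq_smul_one, map_smul, W.map_one', Algebra.algebraMap_eq_smul_one]
      map_star' := W.map_star' }
  refine ⟨W.space, W.nacg, W.ips, W.cplt, W.nontriv, π, ?_⟩
  intro x
  have := congrArg (fun S => x ∈ S) W.ker_eq'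
  exact this.to_iff

lemma prim_sub {P : Set B} (hP : IsPrimitiveIdeal P) :
    ∃ W : Submodule ℂ B, (W : Set B) = P ∧ IsId W ∧ (1 : B) ∉ W := by
  obtain ⟨H, _, _, _, _, π, hπ⟩ := exists_rep hP
  refine ⟨LinearMap.ker (π : B →ₗ[ℂ] (H →L[ℂ] H)), ?_, ?_, ?_⟩
  · ext x
    rw [hπ]
    rfl
  · intro x hx a b
    have hx' : π x = 0 := hx
    change π (a * x * b) = 0
    simp [hx']
  · intro h
    have : π 1 = 0 := h
    rw [map_one] at this
    exact one_ne_zero this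

lemma prim_exists_st {P : Set B} (hP : IsPrimitiveIdeal P) :
    ∃ τ : B →L[ℂ] ℂ, IsSt τ ∧ ∀ x ∈ P, τ x = 0 := by
  obtain ⟨H, _, _, _, _, π, hπ⟩ := exists_rep hP
  obtain ⟨ξ, hξ⟩ := exists_norm_eq H (zero_le_one)
  obtain ⟨τ, h1, h2⟩ := exists_vecSt π ξ hξ
  refine ⟨τ, h1, fun x hx => ?_⟩
  rw [h2, (hπ x).mp hx]
  simp

lemma prim_exists_st_pos {P : Set B} (hP : IsPrimitiveIdeal P) {y : B} (hy : IsSelfAdjoint y)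
    (hyP : y⁺ ∉ P) : ∃ τ : B →L[ℂ] ℂ, IsSt τ ∧ (∀ x ∈ P, τ x = 0) ∧ 0 < (τ y).re := by
  obtain ⟨H, _, _, _, _, π, hπ⟩ := exists_rep hP
  set g := y⁺ with hg
  have hg0 : 0 ≤ g := CFC.posPart_nonneg y
  have hgs : star g = g := (IsSelfAdjoint.of_nonneg hg0).star_eq
  set k := CFC.sqrt g with hk
  have hks : star k = k := (IsSelfAdjoint.of_nonneg (CFC.sqrt_nonneg g)).star_eq
  have hkk : k * k = g := CFC.sqrt_mul_sqrt_self g hg0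
  have hgy : g * y = g * g := by
    conv_lhs => rw [← CFC.posPart_sub_negPart y hy]
    rw [mul_sub, CFC.posPart_mul_negPart, sub_zero]
  have hkg : π (k * g) ≠ 0 := by
    intro h0
    apply hyP
    rw [hπ]
    have : star (π g) * π g = 0 := by
      rw [← map_star, ← map_mul, hgs]
      nth_rewrite 1 [← hkk]
      rw [mul_assoc, map_mul, h0, mul_zero]
    exact CStarRing.star_mul_self_eq_zero_iff _ |>.mp this
  obtain ⟨η, hη⟩ : ∃ η, π (k * g) η ≠ 0 := by
    by_contra h
    push Not at h
    exact hkg (ContinuousLinearMap.ext h)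
  have hadj : ∀ (a : B) (u v : H), inner ℂ (π a u) v = inner ℂ u (π (star a) v) := by
    intro a u v
    rw [map_star, ContinuousLinearMap.star_eq_adjoint, ContinuousLinearMap.adjoint_inner_right]
  have hin : inner ℂ (π g η) (π y (π g η)) = inner ℂ (π (k * g) η) (π (k * g) η) := by
    rw [hadj, hadj, star_mul, hks, hgs]
    simp only [← ContinuousLinearMap.mul_apply, ← map_mul]
    congr 3
    rw [← mul_assoc, hgy]
    simp only [mul_assoc]
    rw [← mul_assoc k k, hkk]
  have hξ : π g η ≠ 0 := by
    intro h0
    apply hη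
    rw [map_mul, ContinuousLinearMap.mul_apply, h0, map_zero]
  have hn : 0 < ‖π g η‖ := norm_pos_iff.mpr hξ
  obtain ⟨τ, h1, h2⟩ := exists_vecSt π (((‖π g η‖⁻¹ : ℝ) : ℂ) • π g η) (by
    rw [norm_smul]; simp; field_simp)
  refine ⟨τ, h1, fun x hx => ?_, ?_⟩
  · rw [h2, (hπ x).mp hx]
    simp
  · rw [h2, map_smul, inner_smul_left, inner_smul_right, Complex.conj_ofReal, hin,
      Complex.re_ofReal_mul, Complex.re_ofReal_mul]
    have := (inner_self_eq_norm_sq (𝕜 := ℂ) (π (k * g) η))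
    have h3 : (inner ℂ (π (k * g) η) (π (k * g) η)).re = ‖π (k * g) η‖ ^ 2 := this
    rw [h3]
    have := norm_pos_iff.mpr hη
    positivity

/-- intersections of primitive ideals -/
def interPrim (p : Set B → Prop) : Submodule ℂ B where
  carrier := {x | ∀ P, IsPrimitiveIdeal P → p P → x ∈ P}
  add_mem' := by
    intro x y hx hy P hP hp
    obtain ⟨W, rfl, -⟩ := prim_sub hP
    exact W.add_mem (hx _ hP hp) (hy _ hP hp)
  zero_mem' := by
    intro P hP hp
    obtain ⟨W, rfl, -⟩ := prim_sub hP
    exact W.zero_mem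
  smul_mem' := by
    intro c x hx P hP hp
    obtain ⟨W, rfl, -⟩ := prim_sub hP
    exact W.smul_mem c (hx _ hP hp)

lemma mem_interPrim {p : Set B → Prop} {x : B} :
    x ∈ interPrim p ↔ ∀ P, IsPrimitiveIdeal P → p P → x ∈ P := Iff.rfl

lemma isId_interPrim (p : Set B → Prop) : IsId (interPrim p) := by
  intro x hx a b P hP hp
  obtain ⟨W, rfl, hW, -⟩ := prim_sub hP
  exact hW x (hx _ hP hp) a b

lemma closedIdeal_sub {J : Set B} (hJ : IsClosedIdeal J) :
    ∃ W : Submodule ℂ B, (W : Set B) = J ∧ IsId W := by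
  obtain ⟨-, h0, hadd, hsmul, hmul⟩ := hJ
  exact ⟨{ carrier := J, add_mem' := fun {a b} ha hb => hadd a ha b hb, zero_mem' := h0
           smul_mem' := fun c x hx => hsmul c x hx }, rfl, fun x hx a b =>
    (hmul b _ (hmul a x hx).1).2⟩

/-- With Hausdorff spectrum, primitive ideals are maximal. -/
lemma prim_comax (hT2 : HasHausdorffPrimitiveSpectrum B) {Q : Set B} (hQ : IsPrimitiveIdeal Q)
    {J : Submodule ℂ B} (hJ : IsId J) (hJQ : ¬ (J : Set B) ⊆ Q) :
    ∃ j ∈ J, ∃ q ∈ Q, j + q = 1 := by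
  obtain ⟨W, rfl, hW, hW1⟩ := prim_sub hQ
  by_contra hcon
  have h1 : (1 : B) ∉ J ⊔ W := by
    rw [Submodule.mem_sup]
    rintro ⟨j, hj, q, hq, h⟩
    exact hcon ⟨j, hj, q, hq, h⟩
  have hid : ∀ x ∈ J ⊔ W, ∀ a b, a * x * b ∈ J ⊔ W := by
    intro x hx a b
    rw [Submodule.mem_sup] at hx ⊢
    obtain ⟨j, hj, q, hq, rfl⟩ := hx
    exact ⟨_, hJ j hj a b, _, hW q hq a b, by noncomm_ring⟩
  obtain ⟨R, hR, hsub⟩ := exists_prim_of_proper _ hid h1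
  have hne : (W : Set B) ≠ R := by
    rintro rfl
    exact hJQ (fun x hx => hsub (Submodule.mem_sup_left hx))
  obtain ⟨I, J', -, -, hI, hJ', hS⟩ := hT2 _ R hQ hR hne
  rcases hS _ hQ with h | h
  · exact hI h
  · exact hJ' (fun x hx => hsub (Submodule.mem_sup_right (h hx)))

lemma prim_inf (hT2 : HasHausdorffPrimitiveSpectrum B) {Q : Set B} (hQ : IsPrimitiveIdeal Q)
    {J J' : Submodule ℂ B} (hJ : IsId J) (hJ' : IsId J') (hJQ : ¬ (J : Set B) ⊆ Q)
    (hJQ' : ¬ (J' : Set B) ⊆ Q) : ¬ ((J ⊓ J' : Submodule ℂ B) : Set B) ⊆ Q := by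
  obtain ⟨j, hj, q, hq, h⟩ := prim_comax hT2 hQ hJ hJQ
  obtain ⟨j', hj', q', hq', h'⟩ := prim_comax hT2 hQ hJ' hJQ'
  obtain ⟨W, rfl, hW, hW1⟩ := prim_sub hQ
  intro hsub
  apply hW1
  have hm : j * j' ∈ W := hsub ⟨by simpa using hJ j hj 1 j', by simpa using hJ' j' hj' j 1⟩
  have e : (1 : B) = j * j' + (j * q' * 1 + q) := by
    have : j * (j' + q') + q = 1 := by rw [h', mul_one, h]
    calc (1 : B) = j * (j' + q') + q := this.symm
      _ = _ := by noncomm_ring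
  rw [e]
  exact W.add_mem hm (W.add_mem (hW q' hq' _ _) hq)

lemma prim_finset_inf (hT2 : HasHausdorffPrimitiveSpectrum B) {Q : Set B}
    (hQ : IsPrimitiveIdeal Q) {ι : Type*} (s : Finset ι) (J : ι → Submodule ℂ B)
    (hJ : ∀ i, IsId (J i)) (hJQ : ∀ i, ¬ (J i : Set B) ⊆ Q) :
    IsId (s.inf J) ∧ ¬ ((s.inf J : Submodule ℂ B) : Set B) ⊆ Q := by
  classical
  induction s using Finset.induction_on with
  | empty =>
    refine ⟨fun x hx a b => by simp, ?_⟩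
    intro h
    obtain ⟨W, rfl, hW, hW1⟩ := prim_sub hQ
    exact hW1 (h (by simp))
  | insert i s hi ih =>
    rw [Finset.inf_insert]
    exact ⟨fun x hx a b => ⟨hJ i x hx.1 a b, ih.1 x hx.2 a b⟩,
      prim_inf hT2 hQ (hJ i) ih.1 (hJQ i) ih.2⟩

/-- `f P` is the top of the numerical range of `h` modulo `P`. -/
def IsTopFn (h : B) (f : Set B → ℝ) : Prop :=
  ∀ P, IsPrimitiveIdeal P →
    (∃ σ : B →L[ℂ] ℂ, IsSt σ ∧ (∀ x ∈ P, σ x = 0) ∧ (σ h).re = f P) ∧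
    ∀ τ : B →L[ℂ] ℂ, IsSt τ → (∀ x ∈ P, τ x = 0) → (τ h).re ≤ f P

lemma exists_isTop (h : B) : ∃ f : Set B → ℝ, IsTopFn h f := by
  have : ∀ P : Set B, ∃ r : ℝ, IsPrimitiveIdeal P →
    (∃ σ : B →L[ℂ] ℂ, IsSt σ ∧ (∀ x ∈ P, σ x = 0) ∧ (σ h).re = r) ∧
    ∀ τ : B →L[ℂ] ℂ, IsSt τ → (∀ x ∈ P, τ x = 0) → (τ h).re ≤ r := by
    intro P
    by_cases hP : IsPrimitiveIdeal P
    · obtain ⟨τ, h1, h2⟩ := prim_exists_st hP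
      obtain ⟨σ, h3, h4, h5⟩ := exists_max_st P h h1 h2
      exact ⟨(σ h).re, fun _ => ⟨⟨σ, h3, h4, rfl⟩, h5⟩⟩
    · exact ⟨0, fun h => (hP h).elim⟩
  choose f hf using this
  exact ⟨f, hf⟩

lemma claim_upper (hT2 : HasHausdorffPrimitiveSpectrum B) {h : B} {f : Set B → ℝ}
    (hf : IsTopFn h f) {Q : Set B} (hQ : IsPrimitiveIdeal Q) {b : ℝ} (hb : f Q < b) :
    ¬ (interPrim (fun P => b ≤ f P) : Set B) ⊆ Q := by
  have hex : ∀ P : {P : Set B // IsPrimitiveIdeal P ∧ b ≤ f P}, ∃ (I : Set B) (J : Submodule ℂ B),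
      IsClosedIdeal I ∧ IsId J ∧ ¬ I ⊆ P.1 ∧ ¬ (J : Set B) ⊆ Q ∧
      ∀ S : Set B, IsPrimitiveIdeal S → I ⊆ S ∨ (J : Set B) ⊆ S := by
    rintro ⟨P, hP, hbP⟩
    have hne : P ≠ Q := by rintro rfl; linarith
    obtain ⟨I, J, h1, h2, h3⟩ := hT2 P Q hP hQ hne
    obtain ⟨W, rfl, hW⟩ := closedIdeal_sub h2
    exact ⟨I, W, h1, hW, h3⟩
  choose I J hI hJ hIP hJQ hS using hex
  let K : Set (WeakDual ℂ B) := stSet ∅ ∩ {τ : WeakDual ℂ B | b ≤ (τ h).re}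
  have hK : IsCompact K := (isCompact_stSet ∅).inter_right
    (isClosed_le continuous_const (Complex.continuous_re.comp (WeakDual.eval_continuous h)))
  obtain ⟨s, hs⟩ := hK.elim_finite_subfamily_closed
    (fun P => {τ : WeakDual ℂ B | ∀ x ∈ I P, τ x = 0})
    (fun P => by
      have : {τ : WeakDual ℂ B | ∀ x ∈ I P, τ x = 0} =
        ⋂ x ∈ I P, {τ : WeakDual ℂ B | τ x = 0} := by ext; simp
      rw [this]
      exact isClosed_biInter fun a _ => isClosed_eq (WeakDual.eval_continuous _) continuous_const)
    (by
      rw [Set.eq_empty_iff_forall_notMem]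
      rintro τ ⟨⟨hτ1, hτ2⟩, hτ3⟩
      rw [Set.mem_iInter] at hτ3
      obtain ⟨S, σ, hS1, hS2, hσ, hσS, hle⟩ := exists_prim_of_st (⋃ P, I P) (by
        intro x hx a c
        rw [Set.mem_iUnion] at hx ⊢
        obtain ⟨P, hx⟩ := hx
        obtain ⟨-, -, -, -, hmul⟩ := hI P
        exact ⟨P, (hmul c _ (hmul a x hx).1).2⟩) h hτ1.1 (by
        intro x hx
        rw [Set.mem_iUnion] at hx
        obtain ⟨P, hx⟩ := hx
        exact hτ3 P x hx)
      have hbS : b ≤ f S := (hτ2.trans hle).trans ((hf S hS1).2 σ hσ hσS)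
      exact hIP ⟨S, hS1, hbS⟩ (fun x hx => hS2 (Set.mem_iUnion.mpr ⟨_, hx⟩)))
  obtain ⟨-, hinf⟩ := prim_finset_inf hT2 hQ s J hJ hJQ
  intro hsub
  apply hinf
  refine Set.Subset.trans ?_ hsub
  intro x hx P hP hbP
  obtain ⟨σ, hσ, hσP, hσh⟩ := (hf P hP).1
  have hσK : StrongDual.toWeakDual σ ∈ K := ⟨⟨hσ, by simp⟩, by
    change b ≤ (σ h).re
    rw [hσh]; exact hbP⟩
  have : ∃ R ∈ s, ¬ ∀ x ∈ I R, σ x = 0 := by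
    by_contra hcon
    push Not at hcon
    have : StrongDual.toWeakDual σ ∈ K ∩ ⋂ i ∈ s, {τ : WeakDual ℂ B | ∀ x ∈ I i, τ x = 0} :=
      ⟨hσK, by simp only [Set.mem_iInter]; exact hcon⟩
    rw [hs] at this
    exact this
  obtain ⟨R, hRs, hR⟩ := this
  rcases hS R P hP with h1 | h1
  · exact (hR (fun x hx => hσP x (h1 hx))).elim
  · exact h1 ((Finset.inf_le hRs : s.inf J ≤ J R) hx)

lemma claim_lower {h : B} (hh : IsSelfAdjoint h) {f : Set B → ℝ}
    (hf : IsTopFn h f) {Q : Set B} (hQ : IsPrimitiveIdeal Q) {a : ℝ} (ha : a < f Q) :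
    ¬ (interPrim (fun P => f P ≤ a) : Set B) ⊆ Q := by
  have hsa : IsSelfAdjoint (h - algebraMap ℝ B a) :=
    hh.sub (IsSelfAdjoint.algebraMap B (IsSelfAdjoint.all a))
  have hev : ∀ τ : B →L[ℂ] ℂ, IsSt τ → (τ (h - algebraMap ℝ B a)).re = (τ h).re - a := by
    intro τ hτ
    rw [map_sub, Algebra.algebraMap_eq_smul_one, ← Complex.coe_smul, map_smul, hτ.one]
    simp
  intro hsub
  obtain ⟨σ, hσ, hσQ, hσh⟩ := (hf Q hQ).1
  have hmem : (h - algebraMap ℝ B a)⁺ ∈ Q := by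
    apply hsub
    intro P hP hPa
    by_contra hn
    obtain ⟨τ, h1, h2, h3⟩ := prim_exists_st_pos hP hsa hn
    rw [hev τ h1] at h3
    have := (hf P hP).2 τ h1 h2
    linarith
  have h1 := hσ.mono (CFC.le_posPart (a := h - algebraMap ℝ B a) hsa)
  rw [hσQ _ hmem, hev σ hσ] at h1
  simp at h1
  linarith

end Aux4

section Aux5

set_option linter.unusedSectionVars false

variable {B : Type u} [CStarAlgebra B] [PartialOrder B] [StarOrderedRing B]

lemma IsSt.map_alg {τ : B →L[ℂ] ℂ} (h : IsSt τ) (r : ℝ) : τ (algebraMap ℝ B r) = (r : ℂ) := by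
  rw [Algebra.algebraMap_eq_smul_one, ← Complex.coe_smul, map_smul, h.one]
  simp

lemma isSelfAdjoint_alg (r : ℝ) : IsSelfAdjoint (algebraMap ℝ B r) :=
  IsSelfAdjoint.algebraMap B (IsSelfAdjoint.all r)

/-- normalization of a left-generating family -/
lemma norm_fam {ι : Type*} (s : Finset ι) (j b : ι → B) (h : ∑ k ∈ s, b k * j k = 1) :
    ∃ T : B, ∑ k ∈ s, star (j k * T) * (j k * T) = 1 := by
  set S : B := ∑ k ∈ s, star (j k) * j k with hS
  have hS0 : 0 ≤ S := Finset.sum_nonneg fun k _ => star_mul_self_nonneg (j k)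
  have hSu : IsUnit S := by
    by_contra hu
    obtain ⟨τ, hτ, hτS⟩ := exists_st_of_not_isUnit (IsSelfAdjoint.of_nonneg hS0) hu
    rw [hS, map_sum] at hτS
    have h0 := (Finset.sum_eq_zero_iff_of_nonneg (fun k _ => hτ.pos (j k))).mp hτS
    have h1 : τ 1 = 0 := by
      rw [← h, map_sum]
      exact Finset.sum_eq_zero fun k hk => hτ.cs (h0 k hk) (b k)
    rw [hτ.one] at h1
    exact one_ne_zero h1
  have hR : IsUnit (CFC.sqrt S) := (CFC.isUnit_sqrt_iff S hS0).mpr hSu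
  have hRs : star (CFC.sqrt S) = CFC.sqrt S :=
    (IsSelfAdjoint.of_nonneg (CFC.sqrt_nonneg S)).star_eq
  obtain ⟨u, hu⟩ := hR
  have hRR : (u : B) * u = S := by rw [hu]; exact CFC.sqrt_mul_sqrt_self S hS0
  have hus : star u = u := Units.ext (by rw [Units.coe_star, hu, hRs])
  have hTs : star (↑u⁻¹ : B) = ↑u⁻¹ := by
    rw [← Units.coe_star, star_inv, hus]
  refine ⟨↑u⁻¹, ?_⟩
  calc ∑ k ∈ s, star (j k * (↑u⁻¹ : B)) * (j k * ↑u⁻¹)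
      = (↑u⁻¹ : B) * S * ↑u⁻¹ := by
        rw [hS, Finset.mul_sum, Finset.sum_mul]
        refine Finset.sum_congr rfl fun k _ => ?_
        rw [star_mul, hTs]
        simp only [mul_assoc]
    _ = 1 := by
        rw [← hRR]
        simp

lemma norm_le_of_abs_le {y : B} (hy : IsSelfAdjoint y) {δ : ℝ} (hδ : 0 ≤ δ)
    (h1 : y ≤ algebraMap ℝ B δ) (h2 : -algebraMap ℝ B δ ≤ y) : ‖y‖ ≤ δ := by
  rcases subsingleton_or_nontrivial B with h | h
  · rw [Subsingleton.elim y 0, norm_zero]; exact hδ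
  · rcases CStarAlgebra.norm_or_neg_norm_mem_spectrum hy with h3 | h3
    · exact (le_algebraMap_iff_spectrum_le hy).mp h1 _ h3
    · rw [← map_neg] at h2
      have := (algebraMap_le_iff_le_spectrum hy).mp h2 _ h3
      linarith

lemma norm_le_of_forall_prim {y : B} (hy : IsSelfAdjoint y) {δ : ℝ} (hδ : 0 ≤ δ)
    (h : ∀ (P : Set B) (τ : B →L[ℂ] ℂ), IsPrimitiveIdeal P → IsSt τ → (∀ x ∈ P, τ x = 0) →
      |(τ y).re| ≤ δ) : ‖y‖ ≤ δ := by
  refine norm_le_of_abs_le hy hδ ?_ ?_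
  · rw [← sub_nonneg]
    refine nonneg_of_forall_prim ((isSelfAdjoint_alg δ).sub hy) fun P τ hP hτ hτP => ?_
    rw [map_sub, hτ.map_alg, Complex.sub_re, Complex.ofReal_re]
    linarith [(abs_le.mp (h P τ hP hτ hτP)).2]
  · rw [← sub_nonneg]
    refine nonneg_of_forall_prim (hy.sub (isSelfAdjoint_alg δ).neg) fun P τ hP hτ hτP => ?_
    rw [map_sub, map_neg, hτ.map_alg, Complex.sub_re, Complex.neg_re, Complex.ofReal_re]
    linarith [(abs_le.mp (h P τ hP hτ hτP)).1]

lemma isId_finset_iSup {ι : Type*} (s : Finset ι) (J : ι → Submodule ℂ B)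
    (hJ : ∀ i, IsId (J i)) : IsId (⨆ i ∈ s, J i) := by
  intro x hx a b
  rw [Submodule.mem_iSup_finset_iff_exists_sum] at hx ⊢
  obtain ⟨μ, rfl⟩ := hx
  refine ⟨fun i => ⟨a * μ i * b, hJ i _ (μ i).2 a b⟩, ?_⟩
  rw [Finset.mul_sum, Finset.sum_mul]

lemma approx_top (hT2 : HasHausdorffPrimitiveSpectrum B) {h : B} (hh : IsSelfAdjoint h)
    {f : Set B → ℝ} (hf : IsTopFn h f) {ε : ℝ} (hε : 0 < ε) :
    ∃ y : B, IsSelfAdjoint y ∧ ∀ (P : Set B) (τ : B →L[ℂ] ℂ), IsPrimitiveIdeal P → IsSt τ →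
      (∀ x ∈ P, τ x = 0) → |(τ y).re - f P| ≤ ε := by
  obtain ⟨N, hN⟩ := exists_nat_gt (‖h‖ / ε + 1)
  let s : Finset ℤ := Finset.Icc (-(N : ℤ)) N
  let c : ℤ → ℝ := fun k => k * ε
  let J : ℤ → Submodule ℂ B := fun k => interPrim (fun P => f P ≤ c k - ε ∨ c k + ε ≤ f P)
  have hJ : ∀ k, IsId (J k) := fun k => isId_interPrim _
  have hbound : ∀ P, IsPrimitiveIdeal P → |f P| ≤ ‖h‖ := by
    intro P hP
    obtain ⟨σ, hσ, -, hσh⟩ := (hf P hP).1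
    rw [← hσh]
    calc |(σ h).re| ≤ ‖σ h‖ := Complex.abs_re_le_norm _
      _ ≤ ‖σ‖ * ‖h‖ := σ.le_opNorm h
      _ ≤ 1 * ‖h‖ := by gcongr; exact hσ.norm
      _ = ‖h‖ := one_mul _
  have h1 : (1 : B) ∈ ⨆ k ∈ s, J k := by
    by_contra hcon
    obtain ⟨Q, hQ, hsub⟩ := exists_prim_of_proper _ (isId_finset_iSup s J hJ) hcon
    have hb := abs_le.mp (hbound Q hQ)
    set k : ℤ := ⌊f Q / ε⌋ with hk
    have hk1 : (k : ℝ) ≤ f Q / ε := Int.floor_le _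
    have hk2 : f Q / ε < k + 1 := Int.lt_floor_add_one _
    have hks : k ∈ s := by
      rw [Finset.mem_Icc]
      have e1 : f Q / ε ≤ ‖h‖ / ε := by gcongr; exact hb.2
      have e2 : -(‖h‖ / ε) ≤ f Q / ε := by rw [← neg_div]; gcongr; exact hb.1
      constructor
      · have : (-(N : ℝ)) ≤ k := by linarith
        exact_mod_cast this
      · have : (k : ℝ) ≤ N := by linarith
        exact_mod_cast this
    rw [le_div_iff₀ hε] at hk1
    rw [div_lt_iff₀ hε] at hk2
    have hA := claim_lower hh hf hQ (a := c k - ε) (by simp only [c]; linarith)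
    have hC := claim_upper hT2 hf hQ (b := c k + ε) (by simp only [c]; linarith)
    refine prim_inf hT2 hQ (isId_interPrim _) (isId_interPrim _) hA hC ?_
    refine Set.Subset.trans ?_ hsub
    rintro x ⟨hx1, hx2⟩
    have hxJ : x ∈ J k := by
      rintro P hP (h3 | h3)
      · exact hx1 P hP h3
      · exact hx2 P hP h3
    exact (le_iSup₂_of_le k hks le_rfl : J k ≤ ⨆ k ∈ s, J k) hxJ
  rw [Submodule.mem_iSup_finset_iff_exists_sum] at h1
  obtain ⟨j, hj⟩ := h1
  obtain ⟨T, hT⟩ := norm_fam s (fun k => (j k : B)) (fun _ => 1) (by simpa using hj)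
  set x : ℤ → B := fun k => star ((j k : B) * T) * ((j k : B) * T) with hx
  have hxJ : ∀ k, x k ∈ J k := fun k => by
    simp only [hx]
    rw [← mul_assoc]
    exact hJ k _ (j k).2 _ _
  have hx0 : ∀ k, 0 ≤ x k := fun k => star_mul_self_nonneg _
  refine ⟨∑ k ∈ s, ((c k : ℝ) : ℂ) • x k, ?_, ?_⟩
  · rw [isSelfAdjoint_iff, star_sum]
    refine Finset.sum_congr rfl fun k _ => ?_
    rw [star_smul, (IsSelfAdjoint.of_nonneg (hx0 k)).star_eq]
    simp
  · intro P τ hP hτ hτP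
    have ht0 : ∀ k, 0 ≤ (τ (x k)).re := fun k => (Complex.le_def.mp (hτ.nonneg (hx0 k))).1
    have ht1 : ∑ k ∈ s, (τ (x k)).re = 1 := by
      have := congrArg (fun w => (τ w).re) hT
      simp only [map_sum, Complex.re_sum, hτ.one, Complex.one_re] at this
      exact this
    have e : (τ (∑ k ∈ s, ((c k : ℝ) : ℂ) • x k)).re - f P
        = ∑ k ∈ s, (c k - f P) * (τ (x k)).re := by
      simp only [sub_mul, Finset.sum_sub_distrib]
      rw [← Finset.mul_sum, ht1, mul_one, map_sum, Complex.re_sum]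
      congr 1
      refine Finset.sum_congr rfl fun k _ => ?_
      rw [map_smul, smul_eq_mul, Complex.re_ofReal_mul]
    rw [e]
    calc |∑ k ∈ s, (c k - f P) * (τ (x k)).re|
        ≤ ∑ k ∈ s, |(c k - f P) * (τ (x k)).re| := Finset.abs_sum_le_sum_abs _ _
      _ ≤ ∑ k ∈ s, ε * (τ (x k)).re := by
          refine Finset.sum_le_sum fun k _ => ?_
          rw [abs_mul, abs_of_nonneg (ht0 k)]
          by_cases hk : |c k - f P| ≤ ε
          · exact mul_le_mul_of_nonneg_right hk (ht0 k)
          · have : τ (x k) = 0 := by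
              apply hτP
              refine hxJ k P hP ?_
              push Not at hk
              rcases lt_abs.mp hk with h3 | h3
              · left; linarith
              · right; linarith
            rw [this]
            simp
      _ = ε := by rw [← Finset.mul_sum, ht1, mul_one]

lemma exists_exact_top (hT2 : HasHausdorffPrimitiveSpectrum B) {h : B} (hh : IsSelfAdjoint h)
    {f : Set B → ℝ} (hf : IsTopFn h f) :
    ∃ z : B, IsSelfAdjoint z ∧ ∀ (P : Set B) (τ : B →L[ℂ] ℂ), IsPrimitiveIdeal P → IsSt τ →
      (∀ x ∈ P, τ x = 0) → (τ z).re = f P := by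
  have := fun n : ℕ => approx_top hT2 hh hf (ε := 1 / ((n : ℝ) + 1)) (by positivity)
  choose y hy hyf using this
  have hc : ∀ n m N : ℕ, N ≤ n → N ≤ m → dist (y n) (y m) ≤ 2 * (1 / ((N : ℝ) + 1)) := by
    intro n m N hn hm
    rw [dist_eq_norm]
    refine norm_le_of_forall_prim ((hy n).sub (hy m)) (by positivity) fun P τ hP hτ hτP => ?_
    have h1 := abs_le.mp (hyf n P τ hP hτ hτP)
    have h2 := abs_le.mp (hyf m P τ hP hτ hτP)
    have h3 : 1 / ((n : ℝ) + 1) ≤ 1 / ((N : ℝ) + 1) := by gcongr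
    have h4 : 1 / ((m : ℝ) + 1) ≤ 1 / ((N : ℝ) + 1) := by gcongr
    rw [map_sub, Complex.sub_re, abs_le]
    constructor <;> linarith [h1.1, h1.2, h2.1, h2.2]
  have hlim : Filter.Tendsto (fun N : ℕ => 1 / ((N : ℝ) + 1)) Filter.atTop (nhds 0) :=
    tendsto_one_div_add_atTop_nhds_zero_nat
  have hcau : CauchySeq y := cauchySeq_of_le_tendsto_0 _ hc (by
    simpa using hlim.const_mul 2)
  obtain ⟨z, hz⟩ := cauchySeq_tendsto_of_complete hcau
  refine ⟨z, ?_, ?_⟩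
  · have h1 : Filter.Tendsto (fun n => star (y n)) Filter.atTop (nhds (star z)) := hz.star
    simp only [fun n => (hy n).star_eq] at h1
    exact tendsto_nhds_unique h1 hz
  · intro P τ hP hτ hτP
    have h1 : Filter.Tendsto (fun n => (τ (y n)).re) Filter.atTop (nhds (τ z).re) :=
      ((Complex.continuous_re.comp τ.continuous).tendsto z).comp hz
    have h2 : Filter.Tendsto (fun n => (τ (y n)).re) Filter.atTop (nhds (f P)) := by
      rw [tendsto_iff_dist_tendsto_zero]
      refine squeeze_zero (fun _ => dist_nonneg) (fun n => ?_) hlim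
      rw [Real.dist_eq]
      exact hyf n P τ hP hτ hτP
    exact tendsto_nhds_unique h1 h2

/-- conjugate of a state by a unitary -/
lemma exists_conj_st {τ : B →L[ℂ] ℂ} (hτ : IsSt τ) {u : B} (hu : u ∈ unitary B) :
    ∃ σ : B →L[ℂ] ℂ, IsSt σ ∧ ∀ x, σ x = τ (star u * x * u) := by
  let σ : B →L[ℂ] ℂ := τ.comp ((ContinuousLinearMap.mul ℂ B (star u)).comp
    ((ContinuousLinearMap.mul ℂ B).flip u))
  have hσ : ∀ x, σ x = τ (star u * x * u) := fun x => by simp [σ, mul_assoc]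
  refine ⟨σ, IsSt.of_norm ?_ ?_, hσ⟩
  · refine ContinuousLinearMap.opNorm_le_bound _ zero_le_one fun x => ?_
    rw [hσ]
    have hu1 : ‖u‖ ≤ 1 := by
      have h1 : ‖u‖ * ‖u‖ ≤ 1 := by
        rw [← CStarRing.norm_star_mul_self, Unitary.star_mul_self_of_mem hu]
        exact norm_one_le_aux
      nlinarith [norm_nonneg u]
    have hu2 : ‖star u‖ ≤ 1 := by rw [norm_star]; exact hu1
    calc ‖τ (star u * x * u)‖ ≤ ‖τ‖ * ‖star u * x * u‖ := τ.le_opNorm _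
      _ ≤ 1 * (1 * ‖x‖ * 1) := by
        gcongr
        · exact hτ.norm
        · exact (norm_mul_le _ _).trans (by gcongr; exact (norm_mul_le _ _).trans (by gcongr))
      _ = 1 * ‖x‖ := by ring
  · rw [hσ, mul_one, Unitary.star_mul_self_of_mem hu, hτ.one]

lemma exact_top_center {z : B} (hz : IsSelfAdjoint z) {f : Set B → ℝ}
    (hzf : ∀ (P : Set B) (τ : B →L[ℂ] ℂ), IsPrimitiveIdeal P → IsSt τ →
      (∀ x ∈ P, τ x = 0) → (τ z).re = f P) : z ∈ Set.center B := by
  have hu : ∀ u ∈ unitary B, z * u = u * z := by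
    intro u hu
    have h1 : ‖star u * z * u - z‖ ≤ 0 := by
      refine norm_le_of_forall_prim ((hz.conjugate' u).sub hz) le_rfl fun P τ hP hτ hτP => ?_
      obtain ⟨σ, hσ, hσu⟩ := exists_conj_st hτ hu
      rw [map_sub, Complex.sub_re, ← hσu, hzf P τ hP hτ hτP, hzf P σ hP hσ ?_]
      · simp
      · intro x hx
        rw [hσu]
        apply hτP
        obtain ⟨W, rfl, hW, -⟩ := prim_sub hP
        exact hW x hx _ _
    have h2 : star u * z * u = z := by
      rw [norm_le_zero_iff, sub_eq_zero] at h1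
      exact h1
    calc z * u = (u * star u) * z * u := by rw [Unitary.mul_star_self_of_mem hu, one_mul]
      _ = u * (star u * z * u) := by simp only [mul_assoc]
      _ = u * z := by rw [h2]
  rw [Semigroup.mem_center_iff]
  intro g
  have hg : g ∈ Submodule.span ℂ (unitary B : Set B) := by
    rw [CStarAlgebra.span_unitary]; trivial
  induction hg using Submodule.span_induction with
  | mem x hx => exact (hu x hx).symm
  | zero => simp
  | add x y _ _ h1 h2 => rw [add_mul, mul_add, h1, h2]
  | smul c x _ h1 => rw [smul_mul_assoc, mul_smul_comm, h1]

theorem exists_central_top (hT2 : HasHausdorffPrimitiveSpectrum B) {h : B}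
    (hh : IsSelfAdjoint h) :
    ∃ z : B, IsSelfAdjoint z ∧ z ∈ Set.center B ∧ h ≤ z ∧
      ∀ ε : ℝ, 0 < ε → ∀ P, IsPrimitiveIdeal P → (h - z + algebraMap ℝ B ε)⁺ ∉ P := by
  obtain ⟨f, hf⟩ := exists_isTop h
  obtain ⟨z, hz, hzf⟩ := exists_exact_top hT2 hh hf
  refine ⟨z, hz, exact_top_center hz hzf, ?_, ?_⟩
  · rw [← sub_nonneg]
    refine nonneg_of_forall_prim (hz.sub hh) fun P τ hP hτ hτP => ?_
    rw [map_sub, Complex.sub_re, hzf P τ hP hτ hτP]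
    linarith [(hf P hP).2 τ hτ hτP]
  · intro ε hε P hP hmem
    obtain ⟨σ, hσ, hσP, hσh⟩ := (hf P hP).1
    have hsa : IsSelfAdjoint (h - z + algebraMap ℝ B ε) :=
      (hh.sub hz).add (isSelfAdjoint_alg ε)
    have h1 := hσ.mono (CFC.le_posPart (a := h - z + algebraMap ℝ B ε) hsa)
    rw [hσP _ hmem, map_add, map_sub, hσ.map_alg, Complex.add_re, Complex.sub_re,
      hzf P σ hP hσ hσP, hσh] at h1
    simp at h1
    linarith

end Aux5

section Aux6

set_option linter.unusedSectionVars false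

variable {B : Type u} [CStarAlgebra B] [PartialOrder B] [StarOrderedRing B]

lemma exists_ucp {ι : Type*} (s : Finset ι) (a : ι → B) (ha : ∑ i ∈ s, star (a i) * a i = 1) :
    ∃ φ : B →L[ℂ] B, IsElementaryUCP φ ∧ ∀ x, φ x = ∑ i ∈ s, star (a i) * x * a i := by
  let φ : B →L[ℂ] B := ∑ i ∈ s, (ContinuousLinearMap.mul ℂ B (star (a i))).comp
    ((ContinuousLinearMap.mul ℂ B).flip (a i))
  have hφ : ∀ x, φ x = ∑ i ∈ s, star (a i) * x * a i := by
    intro x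
    simp [φ, mul_assoc]
  refine ⟨φ, ⟨s.card, fun k => a (s.equivFin.symm k), ?_, ?_⟩, hφ⟩
  · rw [← ha, ← Finset.sum_coe_sort s]
    exact Equiv.sum_comp s.equivFin.symm (fun i : s => star (a i) * a i)
  · intro x
    rw [hφ, ← Finset.sum_coe_sort s]
    exact (Equiv.sum_comp s.equivFin.symm (fun i : s => star (a i) * x * a i)).symm

lemma exists_comb {φ ψ : B →L[ℂ] B} (hφ : IsElementaryUCP φ) (hψ : IsElementaryUCP ψ) {p q : B}
    (hpq : star p * p + star q * q = 1) :
    ∃ θ : B →L[ℂ] B, IsElementaryUCP θ ∧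
      ∀ x, θ x = star p * φ x * p + star q * ψ x * q := by
  obtain ⟨n, a, ha, hφ⟩ := hφ
  obtain ⟨m, b, hb, hψ⟩ := hψ
  have key : ∀ x, ∑ i : Fin n ⊕ Fin m, star (Sum.elim (fun i => a i * p) (fun i => b i * q) i) * x *
      Sum.elim (fun i => a i * p) (fun i => b i * q) i
      = star p * (∑ i, star (a i) * x * a i) * p + star q * (∑ i, star (b i) * x * b i) * q := by
    intro x
    rw [Fintype.sum_sum_type]
    simp only [Sum.elim_inl, Sum.elim_inr, Finset.mul_sum, Finset.sum_mul, star_mul, mul_assoc]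
  obtain ⟨θ, h1, h2⟩ := exists_ucp (Finset.univ : Finset (Fin n ⊕ Fin m))
    (Sum.elim (fun i => a i * p) (fun i => b i * q)) (by
      have := key 1
      simp only [mul_one, ha, hb] at this
      rw [this, hpq])
  exact ⟨θ, h1, fun x => by rw [h2, key, hφ, hψ]⟩

lemma ucp_one {φ : B →L[ℂ] B} (hφ : IsElementaryUCP φ) : φ 1 = 1 := by
  obtain ⟨n, a, ha, hφ⟩ := hφ
  rw [hφ]
  simpa using ha

lemma ucp_center_mul {φ : B →L[ℂ] B} (hφ : IsElementaryUCP φ) {z : B} (hz : z ∈ Set.center B)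
    (x : B) : φ (z * x) = z * φ x := by
  obtain ⟨n, a, ha, hφ⟩ := hφ
  rw [hφ, hφ, Finset.mul_sum]
  refine Finset.sum_congr rfl fun i _ => ?_
  have := Semigroup.mem_center_iff.mp hz (star (a i))
  rw [← mul_assoc, this]
  simp only [mul_assoc]

lemma ucp_center {φ : B →L[ℂ] B} (hφ : IsElementaryUCP φ) {z : B} (hz : z ∈ Set.center B) :
    φ z = z := by
  have := ucp_center_mul hφ hz 1
  rwa [mul_one, ucp_one hφ, mul_one] at this

lemma alg_mem_center (r : ℝ) : algebraMap ℝ B r ∈ Set.center B :=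
  Semigroup.mem_center_iff.mpr fun g => (Algebra.commutes r g).symm

lemma ucp_nonneg {φ : B →L[ℂ] B} (hφ : IsElementaryUCP φ) {x : B} (hx : 0 ≤ x) : 0 ≤ φ x := by
  obtain ⟨n, a, ha, hφ⟩ := hφ
  rw [hφ]
  exact Finset.sum_nonneg fun i _ => star_left_conjugate_nonneg hx (a i)

lemma ucp_mono {φ : B →L[ℂ] B} (hφ : IsElementaryUCP φ) {x y : B} (hxy : x ≤ y) :
    φ x ≤ φ y := by
  rw [← sub_nonneg, ← map_sub]
  exact ucp_nonneg hφ (sub_nonneg.mpr hxy)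

lemma ucp_star {φ : B →L[ℂ] B} (hφ : IsElementaryUCP φ) (x : B) : φ (star x) = star (φ x) := by
  obtain ⟨n, a, ha, hφ⟩ := hφ
  rw [hφ, hφ, star_sum]
  refine Finset.sum_congr rfl fun i _ => ?_
  simp [mul_assoc]

lemma ucp_norm_le {φ : B →L[ℂ] B} (hφ : IsElementaryUCP φ) (x : B) : ‖φ x‖ ≤ ‖x‖ := by
  have hstar := ucp_star hφ x
  have h1 : star (φ x) * φ x ≤ φ (star x * x) := by
    obtain ⟨n, a, ha, hφ'⟩ := hφ
    have h0 : 0 ≤ ∑ i, star (x * a i - a i * φ x) * (x * a i - a i * φ x) :=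
      Finset.sum_nonneg fun i _ => star_mul_self_nonneg _
    have e : ∑ i, star (x * a i - a i * φ x) * (x * a i - a i * φ x)
        = φ (star x * x) - φ (star x) * φ x - star (φ x) * φ x
          + star (φ x) * 1 * φ x := by
      rw [← ha, hφ' (star x * x), hφ' (star x)]
      conv_rhs => rw [show star (φ x) * φ x = star (φ x) * (∑ i, star (a i) * x * a i) by
        rw [← hφ']]
      simp only [Finset.mul_sum, Finset.sum_mul, ← Finset.sum_sub_distrib,
        ← Finset.sum_add_distrib]
      refine Finset.sum_congr rfl fun i _ => ?_
      simp only [star_sub, star_mul]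
      noncomm_ring
    rw [e, hstar, mul_one, sub_add_cancel, sub_nonneg] at h0
    exact h0
  have h2 : φ (star x * x) ≤ algebraMap ℝ B (‖x‖ ^ 2) := by
    have := ucp_mono hφ (CStarAlgebra.star_mul_le_algebraMap_norm_sq (a := x))
    rwa [ucp_center hφ (alg_mem_center _)] at this
  have h3 : ‖star (φ x) * φ x‖ ≤ ‖x‖ ^ 2 :=
    (CStarAlgebra.norm_le_iff_le_algebraMap _ (by positivity) (star_mul_self_nonneg _)).mpr
      (h1.trans h2)
  rw [CStarRing.norm_star_mul_self, ← sq] at h3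
  exact le_of_sq_le_sq h3 (norm_nonneg x)

lemma exists_gen {g : B} (hg : ∀ P, IsPrimitiveIdeal P → g ∉ P) :
    ∃ (s : Finset (B × B)) (b c : B × B → B), ∑ k ∈ s, b k * (g * c k) = 1 := by
  let W : Submodule ℂ B := Submodule.span ℂ (Set.range fun p : B × B => p.1 * g * p.2)
  have hW : ∀ x ∈ W, ∀ a b, a * x * b ∈ W := by
    intro x hx a b
    induction hx using Submodule.span_induction with
    | mem x hx =>
      obtain ⟨p, rfl⟩ := hx
      exact Submodule.subset_span ⟨(a * p.1, p.2 * b), by simp [mul_assoc]⟩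
    | zero => simp
    | add x y _ _ h1 h2 =>
      rw [mul_add, add_mul]
      exact W.add_mem h1 h2
    | smul c x _ h1 =>
      rw [mul_smul_comm, smul_mul_assoc]
      exact W.smul_mem c h1
  have h1 : (1 : B) ∈ W := by
    by_contra hcon
    obtain ⟨P, hP, hsub⟩ := exists_prim_of_proper W hW hcon
    exact hg P hP (hsub (Submodule.subset_span ⟨(1, 1), by simp⟩))
  obtain ⟨c, hc⟩ := Finsupp.mem_span_range_iff_exists_finsupp.mp h1
  refine ⟨c.support, fun p => c p • p.1, fun p => p.2, ?_⟩
  rw [← hc, Finsupp.sum]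
  refine Finset.sum_congr rfl fun p _ => ?_
  simp [mul_assoc]

lemma exists_ucp_top {y : B} (hy : IsSelfAdjoint y) (hP : ∀ P, IsPrimitiveIdeal P → y⁺ ∉ P) :
    ∃ φ : B →L[ℂ] B, IsElementaryUCP φ ∧ 0 ≤ φ y := by
  obtain ⟨s, b, c, h1⟩ := exists_gen hP
  obtain ⟨T, hT⟩ := norm_fam s _ _ h1
  obtain ⟨φ, hφ, hφx⟩ := exists_ucp s _ hT
  refine ⟨φ, hφ, ?_⟩
  rw [hφx]
  have hg0 : 0 ≤ y⁺ := CFC.posPart_nonneg y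
  have hgs : star y⁺ = y⁺ := (IsSelfAdjoint.of_nonneg hg0).star_eq
  have hgy : y⁺ * y = y⁺ * y⁺ := by
    conv_lhs => enter [2]; rw [← CFC.posPart_sub_negPart y hy]
    rw [mul_sub, CFC.posPart_mul_negPart, sub_zero]
  have hg3 : 0 ≤ y⁺ * y * y⁺ := by
    rw [hgy]
    have := star_left_conjugate_nonneg hg0 y⁺
    rwa [hgs] at this
  refine Finset.sum_nonneg fun k _ => ?_
  have e : star (y⁺ * c k * T) * y * (y⁺ * c k * T)
      = star (c k * T) * (y⁺ * y * y⁺) * (c k * T) := by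
    simp only [star_mul, hgs, mul_assoc]
  rw [e]
  exact star_left_conjugate_nonneg hg3 _

theorem exists_bounds (hT2 : HasHausdorffPrimitiveSpectrum B) {h : B} (hh : IsSelfAdjoint h) :
    ∃ m M : B, IsSelfAdjoint m ∧ IsSelfAdjoint M ∧ m ∈ Set.center B ∧ M ∈ Set.center B ∧
      m ≤ h ∧ h ≤ M ∧ ∀ ε : ℝ, 0 < ε → ∃ φ ψ : B →L[ℂ] B, IsElementaryUCP φ ∧
        IsElementaryUCP ψ ∧ M - algebraMap ℝ B ε ≤ φ h ∧ ψ h ≤ m + algebraMap ℝ B ε := by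
  obtain ⟨M, hM, hMc, hhM, hMP⟩ := exists_central_top hT2 hh
  obtain ⟨m, hm, hmc, hhm, hmP⟩ := exists_central_top hT2 hh.neg
  have hmc' : -m ∈ Set.center B := Set.neg_mem_center hmc
  refine ⟨-m, M, hm.neg, hM, hmc', hMc, neg_le.mp hhm, hhM, ?_⟩
  intro ε hε
  obtain ⟨φ, hφ, h1⟩ := exists_ucp_top ((hh.sub hM).add (isSelfAdjoint_alg ε)) (hMP ε hε)
  obtain ⟨ψ, hψ, h2⟩ := exists_ucp_top ((hh.neg.sub hm).add (isSelfAdjoint_alg ε)) (hmP ε hε)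
  refine ⟨φ, ψ, hφ, hψ, ?_, ?_⟩
  · rw [map_add, map_sub, ucp_center hφ hMc, ucp_center hφ (alg_mem_center _)] at h1
    rw [← sub_nonneg]
    convert h1 using 1
    abel
  · rw [map_add, map_sub, map_neg, ucp_center hψ hmc, ucp_center hψ (alg_mem_center _)] at h2
    rw [← sub_nonneg]
    convert h2 using 1
    abel

end Aux6

section Aux7

set_option linter.unusedSectionVars false

variable {B : Type u} [CStarAlgebra B] [PartialOrder B] [StarOrderedRing B]

lemma norm_le_mulNorm (ω : B →L[ℂ] ℂ) (c : B) {x : B} (hx : ‖x‖ ≤ 1) :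
    ‖ω (c * x)‖ ≤ mulNorm ω c := by
  refine le_csSup ⟨‖ω‖ * ‖c‖, ?_⟩ ⟨x, hx, rfl⟩
  rintro r ⟨y, hy, rfl⟩
  calc ‖ω (c * y)‖ ≤ ‖ω‖ * ‖c * y‖ := ω.le_opNorm _
    _ ≤ ‖ω‖ * (‖c‖ * 1) := by gcongr; exact (norm_mul_le _ _).trans (by gcongr)
    _ = ‖ω‖ * ‖c‖ := by ring

lemma mulNorm_le (ω : B →L[ℂ] ℂ) (c : B) {r : ℝ} (h : ∀ x : B, ‖x‖ ≤ 1 → ‖ω (c * x)‖ ≤ r) :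
    mulNorm ω c ≤ r := by
  refine csSup_le ⟨_, 0, by simp, rfl⟩ ?_
  rintro t ⟨x, hx, rfl⟩
  exact h x hx

lemma exists_near_mulNorm (ω : B →L[ℂ] ℂ) (c : B) {r : ℝ} (h : r < mulNorm ω c) :
    ∃ x : B, ‖x‖ ≤ 1 ∧ r < ‖ω (c * x)‖ := by
  have hne : {r : ℝ | ∃ x : B, ‖x‖ ≤ 1 ∧ r = ‖ω (c * x)‖}.Nonempty := ⟨_, 0, by simp, rfl⟩
  obtain ⟨t, ⟨x, hx, rfl⟩, hr⟩ := exists_lt_of_lt_csSup hne h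
  exact ⟨x, hx, hr⟩

lemma forward_dir {ω ρ : B →L[ℂ] ℂ} (h : InWeakStarClosure (mixSet ω) ρ) :
    (∀ z ∈ Set.center B, ρ z = ω z) ∧
      ∀ c ∈ Set.center B, mulNorm ρ c ≤ mulNorm ω c := by
  constructor
  · intro z hz
    rw [← sub_eq_zero, ← norm_le_zero_iff]
    refine le_of_forall_pos_le_add fun ε hε => ?_
    obtain ⟨σ, ⟨φ, hφ, rfl⟩, h1⟩ := h ε hε 1 (fun _ => z)
    have := h1 0
    rw [ContinuousLinearMap.comp_apply, ucp_center hφ hz] at this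
    linarith
  · intro c hc
    refine mulNorm_le ρ c fun x hx => ?_
    refine le_of_forall_pos_le_add fun ε hε => ?_
    obtain ⟨σ, ⟨φ, hφ, rfl⟩, h1⟩ := h ε hε 1 (fun _ => c * x)
    have h2 := h1 0
    rw [ContinuousLinearMap.comp_apply, ucp_center_mul hφ hc] at h2
    have h3 := norm_le_mulNorm ω c ((ucp_norm_le hφ x).trans hx)
    have h4 := norm_le_norm_add_norm_sub' (ρ (c * x)) (ω (c * φ x))
    linarith

lemma sa_bounds {x : B} (hx : IsSelfAdjoint x) (h1 : ‖x‖ ≤ 1) : 0 ≤ 1 + x ∧ 0 ≤ 1 - x := by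
  have h2 : algebraMap ℝ B ‖x‖ ≤ algebraMap ℝ B 1 := by
    rw [← sub_nonneg, ← map_sub]
    exact algebraMap_nonneg B (sub_nonneg.mpr h1)
  rw [map_one] at h2
  constructor
  · have := hx.neg_algebraMap_norm_le_self
    have h3 := (neg_le_neg h2).trans this
    rw [← sub_nonneg, sub_neg_eq_add, add_comm] at h3
    exact h3
  · exact sub_nonneg.mpr (hx.le_algebraMap_norm_self.trans h2)

/-- the phase-rotated, self-adjoint near maximizer -/
lemma exists_near_sa {ω : B →L[ℂ] ℂ} (hω : IsHermitianFunctional ω) {c : B}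
    (hc : c ∈ Set.center B) (hcs : IsSelfAdjoint c) {r : ℝ} (h : r < mulNorm ω c) :
    ∃ x : B, IsSelfAdjoint x ∧ ‖x‖ ≤ 1 ∧ r ≤ (ω (c * x)).re := by
  obtain ⟨x, hx, hr⟩ := exists_near_mulNorm ω c h
  obtain ⟨l, hl1, hl2⟩ : ∃ l : ℂ, ‖l‖ ≤ 1 ∧ (l * ω (c * x)).re = ‖ω (c * x)‖ := by
    by_cases h0 : ω (c * x) = 0
    · exact ⟨0, by simp, by simp [h0]⟩
    · have hn : ‖ω (c * x)‖ ≠ 0 := norm_ne_zero_iff.mpr h0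
      refine ⟨conj (ω (c * x)) / (‖ω (c * x)‖ : ℂ), ?_, ?_⟩
      · rw [norm_div, RCLike.norm_conj, Complex.norm_real, norm_norm, div_self hn]
      · rw [div_mul_eq_mul_div, Complex.conj_mul', sq, mul_div_assoc, div_self (by exact_mod_cast hn)]
        simp
  let w : B := l • x
  have hw : ‖w‖ ≤ 1 := by
    rw [norm_smul]
    nlinarith [norm_nonneg l, norm_nonneg x]
  have hww : star (c * w) = c * star w := by
    rw [star_mul, hcs.star_eq, Semigroup.mem_center_iff.mp hc]
  refine ⟨(1 / 2 : ℂ) • (w + star w), ?_, ?_, ?_⟩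
  · rw [isSelfAdjoint_iff, star_smul, star_add, star_star, add_comm]
    simp
  · rw [norm_smul]
    have := norm_add_le w (star w)
    rw [norm_star] at this
    have h2 : ‖(1 / 2 : ℂ)‖ = 1 / 2 := by simp
    rw [h2]
    linarith
  · rw [mul_smul_comm, map_smul, mul_add, map_add, ← hww, hω, mul_smul_comm, map_smul,
      smul_eq_mul, smul_eq_mul, Complex.add_conj, hl2]
    have : ((1 / 2 : ℂ) * (2 * ‖ω (c * x)‖ : ℝ)).re = ‖ω (c * x)‖ := by
      rw [show (1 / 2 : ℂ) = ((1 / 2 : ℝ) : ℂ) by simp, Complex.re_ofReal_mul, Complex.ofReal_re]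
      ring
    rw [this]
    exact hr.le

/-- the norm estimate from `-r ≤ k ≤ r` -/
lemma re_le_mulNorm {ρ : B →L[ℂ] ℂ} {r k : B} (hr : r ∈ Set.center B) (hrs : IsSelfAdjoint r)
    (hk : IsSelfAdjoint k)
    {η : ℝ} (hη : 0 < η) (hrη : algebraMap ℝ B η ≤ r) (h1 : k ≤ r) (h2 : -r ≤ k) :
    (ρ k).re ≤ mulNorm ρ r := by
  have hη0 : 0 ≤ algebraMap ℝ B η := algebraMap_nonneg B hη.le
  have hr0 : 0 ≤ r := hη0.trans hrη
  have hu : IsUnit r := by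
    by_contra hu
    obtain ⟨τ, hτ, h0⟩ := exists_st_of_not_isUnit hrs hu
    have := hτ.mono hrη
    rw [hτ.map_alg, h0] at this
    simp at this
    linarith
  obtain ⟨v, rfl⟩ := hu
  have hvs : star (↑v⁻¹ : B) = ↑v⁻¹ := by
    have : star v = v := Units.ext (by rw [Units.coe_star]; exact hrs)
    rw [← Units.coe_star, star_inv, this]
  have hv0 : 0 ≤ (↑v⁻¹ : B) := by
    have := star_left_conjugate_nonneg hr0 (↑v⁻¹ : B)
    rwa [hvs, Units.inv_mul, one_mul] at this
  have hvc : ∀ g : B, Commute (↑v⁻¹ : B) g := fun g =>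
    Commute.units_inv_left (show (v : B) * g = g * v from (Semigroup.mem_center_iff.mp hr g).symm)
  have hys : IsSelfAdjoint ((↑v⁻¹ : B) * k) := by
    rw [isSelfAdjoint_iff, star_mul, hvs, hk.star_eq]
    exact (hvc k).symm
  have hy : ‖(↑v⁻¹ : B) * k‖ ≤ 1 := by
    refine norm_le_of_abs_le hys zero_le_one ?_ ?_
    · have := Commute.mul_nonneg hv0 (sub_nonneg.mpr h1) (hvc _)
      rw [mul_sub, Units.inv_mul] at this
      rw [map_one]
      exact sub_nonneg.mp this
    · have := Commute.mul_nonneg hv0 (sub_nonneg.mpr h2) (hvc _)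
      rw [mul_sub, mul_neg, Units.inv_mul] at this
      rw [map_one]
      exact sub_nonneg.mp this
  have h3 := norm_le_mulNorm ρ (v : B) hy
  rw [Units.mul_inv_cancel_left] at h3
  exact (Complex.re_le_norm _).trans h3

lemma norm_conj_le {p k : B} (hp : ‖p‖ ≤ 1) : ‖star p * k * p‖ ≤ ‖k‖ := by
  calc ‖star p * k * p‖ ≤ ‖star p‖ * ‖k‖ * ‖p‖ :=
        (norm_mul_le _ _).trans (by gcongr; exact norm_mul_le _ _)
    _ ≤ 1 * ‖k‖ * 1 := by rw [norm_star]; gcongr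
    _ = ‖k‖ := by ring

/-- the mixing of the two extreme maps by a contraction -/
lemma exists_mix {h m M : B} (hmc : m ∈ Set.center B) (hMc : M ∈ Set.center B)
    {φ ψ : B →L[ℂ] B} (hφ : IsElementaryUCP φ) (hψ : IsElementaryUCP ψ) {ε : ℝ}
    (h1 : ‖φ h - M‖ ≤ ε) (h2 : ‖ψ h - m‖ ≤ ε) {x : B} (hx : IsSelfAdjoint x) (hx1 : ‖x‖ ≤ 1) :
    ∃ θ : B →L[ℂ] B, IsElementaryUCP θ ∧
      ‖θ h - ((1 / 2 : ℂ) • (M + m) + ((1 / 2 : ℂ) • (M - m)) * x)‖ ≤ 2 * ε := by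
  obtain ⟨hb1, hb2⟩ := sa_bounds hx hx1
  have aux : ∀ y : B, 0 ≤ 1 + y → ‖y‖ ≤ 1 → ∃ p : B, star p * p = (1 / 2 : ℂ) • (1 + y) ∧ ‖p‖ ≤ 1 := by
    intro y hy hy1
    have hpos : 0 ≤ (1 / 2 : ℂ) • (1 + y) := by
      have : 0 ≤ (1 / 2 : ℝ) • (1 + y) := smul_nonneg (by norm_num) hy
      rw [← Complex.coe_smul] at this
      simpa using this
    obtain ⟨p, hp⟩ := CStarAlgebra.nonneg_iff_eq_star_mul_self.mp hpos
    refine ⟨p, hp.symm, ?_⟩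
    have hn : ‖p‖ * ‖p‖ ≤ 1 := by
      rw [← CStarRing.norm_star_mul_self, ← hp, norm_smul]
      have h4 := norm_add_le (1 : B) y
      have h5 := norm_one_le_aux (B := B)
      have h2 : ‖(1 / 2 : ℂ)‖ = 1 / 2 := by simp
      rw [h2]
      linarith
    nlinarith [norm_nonneg p]
  obtain ⟨p, hp, hp1⟩ := aux x hb1 hx1
  obtain ⟨q, hq, hq1⟩ := aux (-x) (by rwa [← sub_eq_add_neg]) (by rwa [norm_neg])
  obtain ⟨θ, hθ, hθx⟩ := exists_comb hφ hψ (p := p) (q := q) (by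
    rw [hp, hq, ← smul_add]
    have : (1 + x + (1 + -x) : B) = (2 : ℂ) • 1 := by
      rw [two_smul]; abel
    rw [this, smul_smul]
    norm_num)
  refine ⟨θ, hθ, ?_⟩
  have hM : star p * M * p = M * ((1 / 2 : ℂ) • (1 + x)) := by
    rw [Semigroup.mem_center_iff.mp hMc, mul_assoc, hp]
  have hm : star q * m * q = m * ((1 / 2 : ℂ) • (1 + -x)) := by
    rw [Semigroup.mem_center_iff.mp hmc, mul_assoc, hq]
  have e : θ h - ((1 / 2 : ℂ) • (M + m) + ((1 / 2 : ℂ) • (M - m)) * x)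
      = star p * (φ h - M) * p + star q * (ψ h - m) * q := by
    rw [hθx, mul_sub, mul_sub, sub_mul, sub_mul, hM, hm]
    simp only [mul_smul_comm, smul_mul_assoc, mul_add, sub_mul, mul_one, mul_neg, smul_add,
      smul_sub, smul_neg]
    abel
  rw [e]
  calc _ ≤ ‖star p * (φ h - M) * p‖ + ‖star q * (ψ h - m) * q‖ := norm_add_le _ _
    _ ≤ ε + ε := add_le_add ((norm_conj_le hp1).trans h1) ((norm_conj_le hq1).trans h2)
    _ = 2 * ε := by ring

lemma core (hT2 : HasHausdorffPrimitiveSpectrum B) {ω ρ : B →L[ℂ] ℂ}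
    (hω : IsHermitianFunctional ω) (hz : ∀ z ∈ Set.center B, ρ z = ω z)
    (hc : ∀ c ∈ Set.center B, 0 ≤ c → mulNorm ρ c ≤ mulNorm ω c)
    {h : B} (hh : IsSelfAdjoint h) {δ : ℝ} (hδ : 0 < δ) :
    ∃ φ : B →L[ℂ] B, IsElementaryUCP φ ∧ (ρ h).re - δ ≤ (ω (φ h)).re := by
  obtain ⟨m, M, hm, hM, hmc, hMc, hmh, hhM, hex⟩ := exists_bounds hT2 hh
  set η : ℝ := δ / (1 + 3 * ‖ω‖) with hηd
  have hη : 0 < η := by positivity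
  obtain ⟨φ, ψ, hφ, hψ, h1, h2⟩ := hex η hη
  have hφM : ‖φ h - M‖ ≤ η := by
    rw [norm_sub_rev]
    have e1 : φ h ≤ M := by
      have := ucp_mono hφ hhM
      rwa [ucp_center hφ hMc] at this
    exact (CStarAlgebra.norm_le_iff_le_algebraMap _ hη.le (sub_nonneg.mpr e1)).mpr
      (sub_le_comm.mp h1)
  have hψm : ‖ψ h - m‖ ≤ η := by
    have e1 : m ≤ ψ h := by
      have := ucp_mono hψ hmh
      rwa [ucp_center hψ hmc] at this
    exact (CStarAlgebra.norm_le_iff_le_algebraMap _ hη.le (sub_nonneg.mpr e1)).mpr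
      (sub_le_iff_le_add'.mpr h2)
  have half_sa : ∀ y : B, IsSelfAdjoint y → IsSelfAdjoint ((1 / 2 : ℂ) • y) := by
    intro y hy
    rw [isSelfAdjoint_iff, star_smul, hy.star_eq]
    simp
  have smul_c : ∀ (a : ℂ) (y : B), y ∈ Set.center B → a • y ∈ Set.center B := by
    intro a y hy
    rw [Semigroup.mem_center_iff] at hy ⊢
    intro g
    rw [mul_smul_comm, hy g, smul_mul_assoc]
  have half_nonneg : ∀ y : B, 0 ≤ y → 0 ≤ (1 / 2 : ℂ) • y := by
    intro y hy
    have : 0 ≤ (1 / 2 : ℝ) • y := smul_nonneg (by norm_num) hy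
    rw [← Complex.coe_smul] at this
    simpa using this
  set s : B := (1 / 2 : ℂ) • (M + m) with hs
  set r : B := (1 / 2 : ℂ) • (M - m) with hr
  have hsc : s ∈ Set.center B := smul_c _ _ (Set.add_mem_center hMc hmc)
  have hmc' : M - m ∈ Set.center B := by
    rw [sub_eq_add_neg]
    exact Set.add_mem_center hMc (Set.neg_mem_center hmc)
  have hr0 : 0 ≤ r := half_nonneg _ (sub_nonneg.mpr (hmh.trans hhM))
  have hη0 : 0 ≤ algebraMap ℝ B η := algebraMap_nonneg B hη.le
  set r' : B := r + algebraMap ℝ B η with hr'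
  have hrc' : r' ∈ Set.center B := Set.add_mem_center (smul_c _ _ hmc') (alg_mem_center η)
  have hr0' : 0 ≤ r' := add_nonneg hr0 hη0
  have hrs' : IsSelfAdjoint r' := IsSelfAdjoint.of_nonneg hr0'
  have hsplit : ∀ y : B, (1 / 2 : ℂ) • y + (1 / 2 : ℂ) • y = y := by
    intro y
    rw [← add_smul]
    norm_num
  have hsr : s + r = M := by
    rw [hs, hr, ← smul_add]
    have : M + m + (M - m) = M + M := by abel
    rw [this, smul_add, hsplit]
  have hsr2 : s - r = m := by
    rw [hs, hr, ← smul_sub]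
    have : M + m - (M - m) = m + m := by abel
    rw [this, smul_add, hsplit]
  have hk1 : h - s ≤ r' := by
    rw [sub_le_iff_le_add', hr', ← add_assoc, hsr]
    exact hhM.trans (le_add_of_nonneg_right hη0)
  have hk2 : -r' ≤ h - s := by
    rw [le_sub_iff_add_le, hr', neg_add, neg_add_eq_sub]
    have e2 : -algebraMap ℝ B η - r + s = m - algebraMap ℝ B η := by rw [← hsr2]; abel
    rw [e2]
    exact (sub_le_self _ hη0).trans hmh
  have hrho := re_le_mulNorm (ρ := ρ) hrc' hrs' (hh.sub (half_sa _ (hM.add hm))) hη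
    (le_add_of_nonneg_left hr0) hk1 hk2
  rw [map_sub, Complex.sub_re, hz s hsc] at hrho
  have hcr := hc r' hrc' hr0'
  obtain ⟨x, hx, hx1, hxr⟩ := exists_near_sa hω hrc' hrs' (r := mulNorm ω r' - η) (by linarith)
  obtain ⟨θ, hθ, hθn⟩ := exists_mix hmc hMc hφ hψ hφM hψm hx hx1
  refine ⟨θ, hθ, ?_⟩
  rw [← hs, ← hr] at hθn
  have e1 : ω (θ h) = ω (θ h - (s + r * x)) + ω s + ω (r' * x) - ω (algebraMap ℝ B η * x) := by
    rw [hr', add_mul]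
    simp only [map_sub, map_add]
    ring
  have b1 : ‖ω (θ h - (s + r * x))‖ ≤ ‖ω‖ * (2 * η) :=
    (ω.le_opNorm _).trans (by gcongr)
  have b2 : ‖ω (algebraMap ℝ B η * x)‖ ≤ ‖ω‖ * η := by
    refine (ω.le_opNorm _).trans ?_
    gcongr
    rw [← Algebra.smul_def, norm_smul, Real.norm_of_nonneg hη.le]
    nlinarith
  have b1' := (abs_le.mp ((Complex.abs_re_le_norm _).trans b1)).1
  have b2' := (Complex.re_le_norm _).trans b2
  have hδe : η * (1 + 3 * ‖ω‖) = δ := by rw [hηd]; field_simp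
  rw [e1, Complex.sub_re, Complex.add_re, Complex.add_re]
  nlinarith

lemma backward_dir (hT2 : HasHausdorffPrimitiveSpectrum B) {ω ρ : B →L[ℂ] ℂ}
    (hω : IsHermitianFunctional ω) (hρ : IsHermitianFunctional ρ)
    (hz : ∀ z ∈ Set.center B, ρ z = ω z)
    (hc : ∀ c ∈ Set.center B, 0 ≤ c → mulNorm ρ c ≤ mulNorm ω c) :
    InWeakStarClosure (mixSet ω) ρ := by
  intro ε hε n x
  by_contra hcon
  push Not at hcon
  let S : Set (Fin n → ℂ) := {v | ∃ φ : B →L[ℂ] B, IsElementaryUCP φ ∧ v = fun i => ω (φ (x i))}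
  let v0 : Fin n → ℂ := fun i => ρ (x i)
  have hS : Convex ℝ S := by
    rintro v ⟨φ, hφ, rfl⟩ w ⟨ψ, hψ, rfl⟩ a b ha hb hab
    have hsq : ∀ t : ℝ, 0 ≤ t → ∀ y : B, star (((√t : ℝ) : ℂ) • (1 : B)) * y * (((√t : ℝ) : ℂ) • (1 : B))
        = (t : ℂ) • y := by
      intro t ht y
      rw [star_smul, star_one, smul_mul_assoc, one_mul, mul_smul_comm, mul_one, smul_smul]
      congr 1
      have : ((√t * √t : ℝ) : ℂ) = t := by rw [Real.mul_self_sqrt ht]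
      rw [← this]
      simp
    obtain ⟨θ, hθ, hθx⟩ := exists_comb hφ hψ (p := ((√a : ℝ) : ℂ) • (1 : B))
      (q := ((√b : ℝ) : ℂ) • (1 : B)) (by
        have h1 := hsq a ha 1
        have h2 := hsq b hb 1
        rw [mul_one] at h1 h2
        rw [h1, h2, ← add_smul, ← Complex.ofReal_add, hab]
        simp)
    refine ⟨θ, hθ, ?_⟩
    funext i
    rw [hθx, hsq a ha, hsq b hb]
    simp
  have hdisj : Disjoint (Metric.ball v0 ε) S := by
    rw [Set.disjoint_left]
    rintro v hv ⟨φ, hφ, rfl⟩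
    obtain ⟨i, hi⟩ := hcon (ω.comp φ) ⟨φ, hφ, rfl⟩
    rw [Metric.mem_ball, dist_comm] at hv
    have h1 := (dist_pi_lt_iff hε).mp hv i
    rw [dist_eq_norm] at h1
    simp only [v0] at h1
    rw [ContinuousLinearMap.comp_apply] at hi
    linarith
  obtain ⟨f, u, hf1, hf2⟩ := RCLike.geometric_hahn_banach_open (𝕜 := ℂ) (convex_ball v0 ε)
    Metric.isOpen_ball hS hdisj
  set X : B := -∑ i, (f (Pi.single i 1)) • x i with hX
  have hfv : ∀ σ : B →L[ℂ] ℂ, f (fun i => σ (x i)) = -σ X := by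
    intro σ
    rw [hX, map_neg, neg_neg, map_sum]
    have := LinearMap.pi_apply_eq_sum_univ (f : (Fin n → ℂ) →ₗ[ℂ] ℂ) (fun i => σ (x i))
    simp only [ContinuousLinearMap.coe_coe] at this
    rw [this]
    refine Finset.sum_congr rfl fun i _ => ?_
    rw [map_smul, smul_eq_mul, smul_eq_mul, mul_comm]
    congr 2
    funext j
    simp [Pi.single_apply, eq_comm]
  have hv0 := hf1 v0 (Metric.mem_ball_self hε)
  have e0 := hfv ρ
  change f v0 = _ at e0
  rw [e0] at hv0
  have hreh : ∀ σ : B →L[ℂ] ℂ, IsHermitianFunctional σ →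
      (σ ((1 / 2 : ℂ) • (X + star X))).re = (σ X).re := by
    intro σ hσ
    rw [map_smul, map_add, hσ, Complex.add_conj, smul_eq_mul,
      show (1 / 2 : ℂ) = ((1 / 2 : ℝ) : ℂ) by simp, Complex.re_ofReal_mul, Complex.ofReal_re]
    ring
  have hhs : IsSelfAdjoint ((1 / 2 : ℂ) • (X + star X)) := by
    rw [isSelfAdjoint_iff, star_smul, star_add, star_star, add_comm]
    simp
  have hgap : 0 < (ρ X).re + u := by
    simp at hv0
    linarith
  obtain ⟨φ, hφ, hle⟩ := core hT2 hω hz hc hhs (δ := ((ρ X).re + u) / 2) (by linarith)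
  have hherm : IsHermitianFunctional (ω.comp φ) := by
    intro a
    rw [ContinuousLinearMap.comp_apply, ContinuousLinearMap.comp_apply, ucp_star hφ, hω]
  rw [hreh ρ hρ] at hle
  have h5 := hreh (ω.comp φ) hherm
  rw [ContinuousLinearMap.comp_apply, ContinuousLinearMap.comp_apply] at h5
  rw [h5] at hle
  have h6 := hf2 _ ⟨φ, hφ, rfl⟩
  have e6 := hfv (ω.comp φ)
  simp only [ContinuousLinearMap.comp_apply] at e6
  rw [e6] at h6
  simp at h6
  linarith

theorem main_aux (hT2 : HasHausdorffPrimitiveSpectrum B)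
    (ω ρ : B →L[ℂ] ℂ) (hω : IsHermitianFunctional ω) (hρ : IsHermitianFunctional ρ) :
    InWeakStarClosure (mixSet ω) ρ ↔
      ((∀ z ∈ Set.center B, ρ z = ω z) ∧
        ∀ c ∈ Set.center B, IsPositiveElem c → mulNorm ρ c ≤ mulNorm ω c) := by
  constructor
  · intro h
    obtain ⟨h1, h2⟩ := forward_dir h
    exact ⟨h1, fun c hc _ => h2 c hc⟩
  · rintro ⟨h1, h2⟩
    exact backward_dir hT2 hω hρ h1 fun c hc h0 =>
      h2 c hc (CStarAlgebra.nonneg_iff_eq_star_mul_self.mp h0)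

end Aux7

/-- **Theorem.** Let `A` be a unital C*-algebra with Hausdorff primitive
spectrum and center `Z`, and let `ω`, `ρ` be hermitian functionals on `A`.
Then `ρ` lies in the weak* closure of `ω ∘ E(A)` iff `ρ|Z = ω|Z` and
`‖cρ‖ ≤ ‖cω‖` for every positive central `c`. -/
theorem hermitian_mem_weakStarClosure_iff_of_hausdorff
    (hT2 : HasHausdorffPrimitiveSpectrum A)
    (ω ρ : A →L[ℂ] ℂ) (hω : IsHermitianFunctional ω) (hρ : IsHermitianFunctional ρ) :
    InWeakStarClosure (mixSet ω) ρ ↔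
      ((∀ z ∈ Set.center A, ρ z = ω z) ∧
        ∀ c ∈ Set.center A, IsPositiveElem c → mulNorm ρ c ≤ mulNorm ω c) := by
  let i1 : CStarAlgebra A :=
    { (inferInstance : NormedRing A), (inferInstance : StarRing A),
      (inferInstance : CompleteSpace A), (inferInstance : CStarRing A),
      (inferInstance : NormedAlgebra ℂ A), (inferInstance : StarModule ℂ A) with }
  let i2 : PartialOrder A := CStarAlgebra.spectralOrder A
  have i3 : StarOrderedRing A := CStarAlgebra.spectralOrderedRing A
  exact main_aux hT2 ω ρ hω hρ

end
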